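/- arXiv:1411.2790 — 3 statements merged into one kernel-verified Lean document; each statement's English description precedes it below -/
import Mathlib

section
/- Let k be a field with char k ≠ 2 and let ρ be the k-automorphism of the rational function field k(x1,x2,x3,x4) of order 2 defined by ρ(x1) = −x1, ρ(x2) = x4/x2, ρ(x3) = (x4 − 1)(x4 − x1²)/x3, ρ(x4) = x4. Then k(x1,x2,x3,x4)^⟨ρ⟩ is not retract k-rational. -/
open MvPolynomial

noncomputable section

/-- A field extension `K` of `k` is retract `k`-rational if there is a `k`-subalgebra `A` of `K`
whose fraction field is `K`, together with a nonzero polynomial `f ∈ k[x₁,…,xₙ]` and `k`-algebra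
homomorphisms `φ : A → k[x₁,…,xₙ][1/f]` and `ψ : k[x₁,…,xₙ][1/f] → A` with `ψ ∘ φ = id_A`. -/
def IsRetractRational (k K : Type*) [Field k] [Field K] [Algebra k K] : Prop :=
  ∃ A : Subalgebra k K, IsFractionRing A K ∧
    ∃ (n : ℕ) (f : MvPolynomial (Fin n) k), f ≠ 0 ∧
      ∃ (φ : A →ₐ[k] Localization.Away f) (ψ : Localization.Away f →ₐ[k] A),
        ψ.comp φ = AlgHom.id k A

/-- A valuation with angular component on the nonzero elements of a domain. -/
structure AngularComponent (R κ : Type*) [CommRing R] [Field κ] where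
  /-- the valuation -/
  v : R → ℕ
  /-- the angular component -/
  ac : R → κ
  ac_ne_zero : ∀ {x}, x ≠ 0 → ac x ≠ 0
  v_mul : ∀ {x y}, x ≠ 0 → y ≠ 0 → v (x * y) = v x + v y
  ac_mul : ∀ {x y}, x ≠ 0 → y ≠ 0 → ac (x * y) = ac x * ac y
  min_le_v_add : ∀ {x y}, x ≠ 0 → y ≠ 0 → x + y ≠ 0 → min (v x) (v y) ≤ v (x + y)
  v_add : ∀ {x y}, x ≠ 0 → y ≠ 0 → v x < v y → v (x + y) = v x
  ac_add : ∀ {x y}, x ≠ 0 → y ≠ 0 → v x < v y → ac (x + y) = ac x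

namespace AngularComponent

section Construction

variable {R κ : Type*} [CommRing R] [IsDomain R] [WfDvdMonoid R] [Field κ]

lemma exists_eq_pow_mul {p : R} (hp : Prime p) (x : R) :
    ∃ n : ℕ, ∃ y : R, x ≠ 0 → x = p ^ n * y ∧ ¬ p ∣ y := by
  by_cases hx : x = 0
  · exact ⟨0, 0, fun h => absurd hx h⟩
  · obtain ⟨n, y, hy, h⟩ := WfDvdMonoid.max_power_factor hx hp.irreducible
    exact ⟨n, y, fun _ => ⟨h, hy⟩⟩

omit [WfDvdMonoid R] in
lemma pow_mul_unique {p : R} (hp : Prime p) {m n : ℕ} {a b : R} (ha : ¬ p ∣ a) (hb : ¬ p ∣ b)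
    (h : p ^ m * a = p ^ n * b) : m = n ∧ a = b := by
  have key : ∀ {m n : ℕ} {a b : R}, ¬ p ∣ a → p ^ m * a = p ^ n * b → n ≤ m := by
    intro m n a b ha h
    by_contra! hlt
    obtain ⟨d, rfl⟩ := Nat.exists_eq_add_of_lt hlt
    have h' : p ^ m * a = p ^ m * (p * (p ^ d * b)) := by rw [h]; ring
    exact ha ⟨_, mul_left_cancel₀ (pow_ne_zero _ hp.ne_zero) h'⟩
  obtain rfl : m = n := le_antisymm (key hb h.symm) (key ha h)
  exact ⟨rfl, mul_left_cancel₀ (pow_ne_zero _ hp.ne_zero) h⟩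

/-- The angular component attached to a prime element and a residue map. -/
def ofPrime {p : R} (hp : Prime p) (π : R →+* κ) (hπ : ∀ x, π x = 0 ↔ p ∣ x) :
    AngularComponent R κ := by
  choose v u hvu using exists_eq_pow_mul hp
  have hu0 : ∀ {x : R}, x ≠ 0 → u x ≠ 0 := by
    intro x hx h
    exact (hvu x hx).2 (h ▸ dvd_zero p)
  have huniq : ∀ {x : R} {n : ℕ} {y : R}, x ≠ 0 → x = p ^ n * y → ¬ p ∣ y →
      v x = n ∧ u x = y := by
    intro x n y hx h hy
    exact pow_mul_unique hp (hvu x hx).2 hy ((hvu x hx).1.symm.trans h)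
  have hmul : ∀ {x y : R}, x ≠ 0 → y ≠ 0 → v (x * y) = v x + v y ∧ u (x * y) = u x * u y := by
    intro x y hx hy
    refine huniq (mul_ne_zero hx hy) ?_ ?_
    · conv_lhs => rw [(hvu x hx).1, (hvu y hy).1]
      ring
    · intro h
      rcases hp.dvd_or_dvd h with h | h
      · exact (hvu x hx).2 h
      · exact (hvu y hy).2 h
  have hadd : ∀ {x y : R}, x ≠ 0 → y ≠ 0 → v x < v y →
      v (x + y) = v x ∧ ∃ w, u (x + y) = u x + p * w := by
    intro x y hx hy hlt
    obtain ⟨d, hd⟩ := Nat.exists_eq_add_of_lt hlt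
    have h1 : x + y = p ^ v x * (u x + p * (p ^ d * u y)) := by
      conv_lhs => rw [(hvu x hx).1, (hvu y hy).1, hd]
      ring
    have h2 : ¬ p ∣ u x + p * (p ^ d * u y) := by
      intro h
      exact (hvu x hx).2 ((dvd_add_left (Dvd.intro _ rfl)).1 h)
    have h3 : x + y ≠ 0 := by
      rw [h1]
      refine mul_ne_zero (pow_ne_zero _ hp.ne_zero) ?_
      intro h
      exact h2 (h ▸ dvd_zero p)
    obtain ⟨h4, h5⟩ := huniq h3 h1 h2
    exact ⟨h4, _, h5⟩
  exact
  { v := v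
    ac := fun x => π (u x)
    ac_ne_zero := fun {x} hx h => (hvu x hx).2 ((hπ _).1 h)
    v_mul := fun hx hy => (hmul hx hy).1
    ac_mul := fun hx hy => by rw [(hmul hx hy).2, map_mul]
    min_le_v_add := by
      intro x y hx hy hxy
      by_contra! hlt
      obtain ⟨d, hd⟩ := Nat.exists_eq_add_of_lt (hlt.trans_le (min_le_left _ _))
      obtain ⟨e, he⟩ := Nat.exists_eq_add_of_lt (hlt.trans_le (min_le_right _ _))
      have h1 : p ^ v (x + y) * u (x + y) =
          p ^ v (x + y) * (p * (p ^ d * u x + p ^ e * u y)) := by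
        rw [← (hvu _ hxy).1]
        conv_lhs => rw [(hvu x hx).1, (hvu y hy).1]
        rw [hd, he]
        ring
      exact (hvu _ hxy).2 ⟨_, mul_left_cancel₀ (pow_ne_zero _ hp.ne_zero) h1⟩
    v_add := fun hx hy h => (hadd hx hy h).1
    ac_add := fun {x y} hx hy h => by
      obtain ⟨w, hw⟩ := (hadd hx hy h).2
      rw [hw, map_add, (hπ _).2 (Dvd.intro w rfl), add_zero] }

lemma ofPrime_spec {p : R} (hp : Prime p) (π : R →+* κ) (hπ : ∀ x, π x = 0 ↔ p ∣ x) {x : R}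
    (hx : x ≠ 0) : ∃ y, x = p ^ (ofPrime hp π hπ).v x * y ∧ ¬ p ∣ y ∧
      (ofPrime hp π hπ).ac x = π y :=
  have h := (exists_eq_pow_mul hp x).choose_spec.choose_spec hx
  ⟨_, h.1, h.2, rfl⟩

end Construction

variable {R κ : Type*} [CommRing R] [Field κ] (D : AngularComponent R κ)

/-- The tame symbol of `a` and `b` is a square in the residue field. -/
def Tame (a b : R) : Prop := IsSquare (D.ac a ^ D.v b * D.ac b ^ D.v a)

variable {D} {a b c x y : R}

lemma Tame.symm (h : D.Tame a b) : D.Tame b a := by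
  unfold Tame at *
  rwa [mul_comm]

lemma v_sq (hx : x ≠ 0) : D.v (x ^ 2) = 2 * D.v x := by
  rw [pow_two, D.v_mul hx hx]; ring

lemma ac_sq (hx : x ≠ 0) : D.ac (x ^ 2) = D.ac x ^ 2 := by
  rw [pow_two, D.ac_mul hx hx]; ring

lemma Tame.mul (hb : b ≠ 0) (hc : c ≠ 0) (h : D.Tame a b) (h' : D.Tame a c) :
    D.Tame a (b * c) := by
  unfold Tame at *
  rw [D.v_mul hb hc, D.ac_mul hb hc, pow_add, mul_pow]
  obtain ⟨s, hs⟩ := h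
  obtain ⟨t, ht⟩ := h'
  exact ⟨s * t, by linear_combination (D.ac a ^ D.v c * D.ac c ^ D.v a) * hs + s * s * ht⟩

lemma Tame.of_mul (ha : a ≠ 0) (hb : b ≠ 0) (hc : c ≠ 0) (h : D.Tame a (b * c))
    (h' : D.Tame a b) : D.Tame a c := by
  unfold Tame at *
  rw [D.v_mul hb hc, D.ac_mul hb hc, pow_add, mul_pow] at h
  have h1 := D.ac_ne_zero ha
  have h2 := D.ac_ne_zero hb
  obtain ⟨s, hs⟩ := h
  obtain ⟨t, ht⟩ := h'
  have h3 : D.ac a ^ D.v b * D.ac b ^ D.v a ≠ 0 := mul_ne_zero (pow_ne_zero _ h1) (pow_ne_zero _ h2)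
  have ht0 : t ≠ 0 := by
    rintro rfl
    exact h3 (by simpa using ht)
  refine ⟨s / t, ?_⟩
  field_simp
  apply mul_left_cancel₀ h3
  linear_combination t ^ 2 * hs - s ^ 2 * ht

lemma tame_of_even (ha : Even (D.v a)) (hb : Even (D.v b)) : D.Tame a b :=
  IsSquare.mul (hb.isSquare_pow _) (ha.isSquare_pow _)

lemma tame_sq (hx : x ≠ 0) : D.Tame a (x ^ 2) := by
  unfold Tame
  rw [v_sq hx, ac_sq hx]
  exact ⟨D.ac a ^ D.v x * D.ac x ^ D.v a, by ring⟩

lemma Tame.add (hx : x ≠ 0) (hy : y ≠ 0) (hlt : D.v x < D.v y) (h : D.Tame a x) :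
    D.Tame a (x + y) := by
  unfold Tame at *
  rwa [D.v_add hx hy hlt, D.ac_add hx hy hlt]

section NegOneSquare

variable [IsDomain R]

variable (hi : ∃ i : R, i ^ 2 = -1)
include hi

lemma exists_neg_one_sq : D.v (-1) = 0 ∧ ∃ j : κ, D.ac (-1) = j ^ 2 := by
  obtain ⟨i, hi⟩ := hi
  have hi0 : i ≠ 0 := by
    rintro rfl
    simp at hi
  have h1 : D.v 1 = 0 := by
    have := D.v_mul (one_ne_zero (α := R)) one_ne_zero
    rw [mul_one] at this
    lia
  refine ⟨?_, D.ac i, by rw [← hi, ac_sq hi0]⟩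
  have := D.v_mul (neg_ne_zero.2 (one_ne_zero (α := R))) (neg_ne_zero.2 one_ne_zero)
  rw [neg_mul_neg, mul_one, h1] at this
  lia

lemma v_neg (hx : x ≠ 0) : D.v (-x) = D.v x := by
  rw [← neg_one_mul, D.v_mul (neg_ne_zero.2 one_ne_zero) hx, (exists_neg_one_sq hi).1, zero_add]

lemma tame_neg_self (ha : a ≠ 0) : D.Tame a (-a) := by
  unfold Tame
  obtain ⟨j, hj⟩ := (exists_neg_one_sq (D := D) hi).2
  rw [v_neg hi ha, ← neg_one_mul a, D.ac_mul (neg_ne_zero.2 one_ne_zero) ha, hj]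
  exact ⟨D.ac a ^ D.v a * j ^ D.v a, by ring⟩

lemma tame_neg_sq (hx : x ≠ 0) : D.Tame a (-x ^ 2) := by
  obtain ⟨i, hi⟩ := hi
  have h : -x ^ 2 = (i * x) ^ 2 := by rw [mul_pow, hi]; ring
  rw [h]
  refine tame_sq (mul_ne_zero ?_ hx)
  rintro rfl
  simp at hi

lemma ac_eq_of_v_sub_gt (hx : x ≠ 0) (hxy : x - y ≠ 0) (h : D.v x < D.v (x - y)) :
    D.ac y = D.ac x := by
  have := D.ac_add hx (neg_ne_zero.2 hxy) (by rwa [v_neg hi hxy])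
  rwa [show x + -(x - y) = y by ring] at this

lemma v_le_sub (hx : x ≠ 0) (hy : y ≠ 0) (hxy : x - y ≠ 0) (h : D.v x = D.v y) :
    D.v x ≤ D.v (x - y) := by
  have := D.min_le_v_add hx (neg_ne_zero.2 hy) (by rwa [← sub_eq_add_neg])
  rwa [v_neg hi hy, h, min_self, ← sub_eq_add_neg, ← h] at this

lemma tame_norm (ha : a ≠ 0) (hb : b ≠ 0) (h : b = x ^ 2 - a * y ^ 2) : D.Tame a b := by
  by_cases hy : y = 0
  · subst hy
    have hx : x ≠ 0 := by
      rintro rfl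
      exact hb (by simpa using h)
    rw [h, show x ^ 2 - a * 0 ^ 2 = x ^ 2 by ring]
    exact tame_sq hx
  have hay : a * y ^ 2 ≠ 0 := mul_ne_zero ha (pow_ne_zero _ hy)
  have htay : D.Tame a (-(a * y ^ 2)) := by
    rw [show -(a * y ^ 2) = -a * y ^ 2 by ring]
    exact (tame_neg_self hi ha).mul (neg_ne_zero.2 ha) (pow_ne_zero _ hy) (tame_sq hy)
  by_cases hx : x = 0
  · subst hx
    rw [h, show (0 : R) ^ 2 - a * y ^ 2 = -(a * y ^ 2) by ring]
    exact htay
  have hx2 : x ^ 2 ≠ 0 := pow_ne_zero _ hx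
  rcases lt_trichotomy (D.v (x ^ 2)) (D.v (a * y ^ 2)) with hlt | heq | hgt
  · rw [h, sub_eq_add_neg]
    exact (tame_sq hx).add hx2 (neg_ne_zero.2 hay) (by rwa [v_neg hi hay])
  · have hbx := v_le_sub hi hx2 hay (h ▸ hb) heq
    rw [← h] at hbx
    have hv := heq
    rw [v_sq hx, D.v_mul ha (pow_ne_zero _ hy), v_sq hy] at hv
    have hae : Even (D.v a) := ⟨D.v x - D.v y, by lia⟩
    rcases hbx.eq_or_lt with hbx | hbx
    · exact tame_of_even hae ⟨D.v x, by rw [← hbx, v_sq hx]; ring⟩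
    · have hac := ac_eq_of_v_sub_gt hi hx2 (h ▸ hb) (h ▸ hbx)
      rw [D.ac_mul ha (pow_ne_zero _ hy), ac_sq hx, ac_sq hy] at hac
      have hy0 := D.ac_ne_zero hy
      have hsq : IsSquare (D.ac a) := ⟨D.ac x / D.ac y, by field_simp; linear_combination hac⟩
      exact (hsq.pow _).mul (hae.isSquare_pow _)
  · rw [h, sub_eq_add_neg, add_comm]
    exact htay.add (neg_ne_zero.2 hay) hx2 (by rwa [v_neg hi hay])

/-- The symbol `(a, g - q²)` is tame as soon as `g` and `(g - q²)(g - a)` are norms for `a`. -/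
lemma tame_sub_sq {g q : R} (ha : a ≠ 0) (hg : g ≠ 0) (hq : q ≠ 0) (hd : g - q ^ 2 ≠ 0)
    (he : g - a ≠ 0) (h₁ : D.Tame a g) (h₂ : D.Tame a ((g - q ^ 2) * (g - a))) :
    D.Tame a (g - q ^ 2) := by
  have hq2 : q ^ 2 ≠ 0 := pow_ne_zero _ hq
  have of_e : D.Tame a (g - a) → D.Tame a (g - q ^ 2) := fun h =>
    Tame.of_mul ha he hd (by rwa [mul_comm]) h
  rcases lt_trichotomy (D.v g) (D.v (q ^ 2)) with hlt | hgq | hgt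
  · rw [sub_eq_add_neg]
    exact h₁.add hg (neg_ne_zero.2 hq2) (by rwa [v_neg hi hq2])
  · rcases lt_trichotomy (D.v g) (D.v a) with hlt | hga | hgt
    · apply of_e
      rw [sub_eq_add_neg]
      exact h₁.add hg (neg_ne_zero.2 ha) (by rwa [v_neg hi ha])
    · have hqe : D.v (q ^ 2) = D.v q + D.v q := by rw [v_sq hq]; ring
      have hae : Even (D.v a) := ⟨D.v q, by rw [← hga, hgq, hqe]⟩
      rcases (v_le_sub hi hg ha he hga).eq_or_lt with hge | hge
      · exact of_e (tame_of_even hae ⟨D.v q, by rw [← hge, hgq, hqe]⟩)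
      rcases (v_le_sub hi hg hq2 hd hgq).eq_or_lt with hgd | hgd
      · exact tame_of_even hae ⟨D.v q, by rw [← hgd, hgq, hqe]⟩
      have h3 := ac_eq_of_v_sub_gt hi hg he hge
      have h4 := ac_eq_of_v_sub_gt hi hg hd hgd
      have hsq : IsSquare (D.ac a) := ⟨D.ac q, by rw [h3, ← h4, ac_sq hq, pow_two]⟩
      exact (hsq.pow _).mul (hae.isSquare_pow _)
    · apply of_e
      rw [sub_eq_add_neg, add_comm]
      exact (tame_neg_self hi ha).add (neg_ne_zero.2 ha) hg (by rwa [v_neg hi ha])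
  · rw [sub_eq_add_neg, add_comm]
    exact (tame_neg_sq hi hq).add (neg_ne_zero.2 hq2) hg (by rwa [v_neg hi hq2])

end NegOneSquare

end AngularComponent

/-- `b` is represented by the binary form `x² - a y²`. -/
def IsNormForm {F : Type*} [CommRing F] (a b : F) : Prop := ∃ x y : F, b = x ^ 2 - a * y ^ 2

namespace IsNormForm

variable {F : Type*} [Field F] {a b c : F}

lemma map {F' : Type*} [Field F'] (θ : F →+* F') (h : IsNormForm a b) :
    IsNormForm (θ a) (θ b) := by
  obtain ⟨x, y, rfl⟩ := h
  exact ⟨θ x, θ y, by simp⟩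

lemma mul (hb : IsNormForm a b) (hc : IsNormForm a c) : IsNormForm a (b * c) := by
  obtain ⟨x, y, rfl⟩ := hb
  obtain ⟨z, w, rfl⟩ := hc
  exact ⟨x * z + a * y * w, x * w + y * z, by ring⟩

lemma mul_sq (hb : IsNormForm a b) (c : F) : IsNormForm a (c ^ 2 * b) := by
  obtain ⟨x, y, rfl⟩ := hb
  exact ⟨c * x, c * y, by ring⟩

lemma sq_mul_iff (hc : c ≠ 0) : IsNormForm a (c ^ 2 * b) ↔ IsNormForm a b :=
  ⟨fun h => by simpa [← mul_assoc, ← mul_pow, hc] using h.mul_sq c⁻¹, fun h => h.mul_sq c⟩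

lemma sq_mul_left_iff (hc : c ≠ 0) : IsNormForm (c ^ 2 * a) b ↔ IsNormForm a b := by
  constructor
  · rintro ⟨x, y, rfl⟩
    exact ⟨x, c * y, by ring⟩
  · rintro ⟨x, y, rfl⟩
    exact ⟨x, y / c, by field_simp⟩

lemma mul_iff (hb : b ≠ 0) (hc : c ≠ 0) (h : IsNormForm a (b * c)) :
    IsNormForm a b ↔ IsNormForm a c := by
  have hmul : ∀ {b c : F}, b ≠ 0 → IsNormForm a (b * c) → IsNormForm a b → IsNormForm a c := by
    intro b c hb h hab
    have := h.mul hab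
    rw [show b * c * b = b ^ 2 * c by ring] at this
    exact (sq_mul_iff hb).1 this
  exact ⟨hmul hb h, hmul hc (by rwa [mul_comm])⟩

variable (h2 : (2 : F) ≠ 0)
include h2

lemma of_sq {r : F} (hr : r ≠ 0) (b : F) : IsNormForm (r ^ 2) b :=
  ⟨(1 + b) / 2, (1 - b) / (2 * r), by field_simp; ring⟩

lemma symm (hb : b ≠ 0) (h : IsNormForm a b) : IsNormForm b a := by
  obtain ⟨x, y, h⟩ := h
  by_cases hy : y = 0
  · subst hy
    have hx : x ≠ 0 := by
      rintro rfl
      exact hb (by simpa using h)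
    rw [show b = x ^ 2 by rw [h]; ring]
    exact of_sq h2 hx a
  · exact ⟨x / y, 1 / y, by field_simp; linear_combination h⟩

lemma symm_iff (ha : a ≠ 0) (hb : b ≠ 0) : IsNormForm a b ↔ IsNormForm b a :=
  ⟨symm h2 hb, symm h2 ha⟩

end IsNormForm

open Polynomial in
/-- The angular component on polynomials attached to an irreducible polynomial. -/
def angularComponent {M : Type*} [Field M] (p : M[X]) [hp : Fact (Irreducible p)] :
    AngularComponent M[X] (AdjoinRoot p) :=
  AngularComponent.ofPrime hp.out.prime (AdjoinRoot.mk p) fun _ => AdjoinRoot.mk_eq_zero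

open Polynomial in
/-- All tame symbols of `a` and `b` at the closed points of the affine line are trivial. -/
def IsUnramified {M : Type*} [Field M] (a b : M[X]) : Prop :=
  ∀ (p : M[X]) [Fact (Irreducible p)], (angularComponent p).Tame a b

section Descent

open Polynomial AngularComponent

variable {M : Type*} [Field M] {a b : M[X]}

lemma exists_dvd_sq_sub_of_irreducible (ha : a ≠ 0) (hb : b ≠ 0) (hsq : Squarefree b)
    (h : IsUnramified a b) {p : M[X]} (hp : Irreducible p) (hpb : p ∣ b) :
    ∃ s, p ∣ s ^ 2 - a := by
  by_cases hpa : p ∣ a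
  · exact ⟨0, by simpa using hpa⟩
  have : Fact (Irreducible p) := ⟨hp⟩
  have ht := h p
  obtain ⟨a', ha1, ha2, ha3⟩ := ofPrime_spec hp.prime (AdjoinRoot.mk p)
    (fun _ => AdjoinRoot.mk_eq_zero) ha
  obtain ⟨b', hb1, hb2, hb3⟩ := ofPrime_spec hp.prime (AdjoinRoot.mk p)
    (fun _ => AdjoinRoot.mk_eq_zero) hb
  unfold Tame angularComponent at ht
  rw [ha3, hb3] at ht
  generalize (ofPrime hp.prime (AdjoinRoot.mk p) (fun _ => AdjoinRoot.mk_eq_zero)).v a = i at *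
  generalize (ofPrime hp.prime (AdjoinRoot.mk p) (fun _ => AdjoinRoot.mk_eq_zero)).v b = j at *
  have hi : i = 0 := by
    by_contra hi
    exact hpa (ha1 ▸ (dvd_pow_self p hi).mul_right _)
  have hj : j = 1 := by
    rcases j with _ | _ | j
    · rw [pow_zero, one_mul] at hb1
      exact absurd (hb1 ▸ hpb) hb2
    · rfl
    · refine absurd (hsq p ⟨p ^ j * b', ?_⟩) hp.not_isUnit
      conv_lhs => rw [hb1]
      ring
  subst hi hj
  rw [pow_zero, one_mul] at ha1
  rw [pow_one, pow_zero, mul_one, ← ha1] at ht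
  obtain ⟨t, ht⟩ := ht
  obtain ⟨s, rfl⟩ := AdjoinRoot.mk_surjective t
  refine ⟨s, AdjoinRoot.mk_eq_zero.1 ?_⟩
  rw [map_sub, map_pow, ht, pow_two, sub_self]

/-- The Chinese remainder theorem for square roots modulo a squarefree element. -/
lemma exists_dvd_sq_sub_of_squarefree (a b : M[X]) (hb : b ≠ 0) (hsq : Squarefree b)
    (h : ∀ p : M[X], Irreducible p → p ∣ b → ∃ s, p ∣ s ^ 2 - a) : ∃ s, b ∣ s ^ 2 - a := by
  induction b using UniqueFactorizationMonoid.induction_on_prime with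
  | h₁ => exact absurd rfl hb
  | h₂ x hx => exact ⟨0, hx.dvd⟩
  | h₃ b p hb' hp ih =>
    obtain ⟨s, hs⟩ := ih hb' (hsq.of_mul_right) fun q hq hqb => h q hq (hqb.mul_left p)
    obtain ⟨t, ht⟩ := h p hp.irreducible (dvd_mul_right p b)
    have hpb : IsCoprime p b := by
      refine (hp.irreducible.coprime_iff_not_dvd).2 fun hdvd => hp.not_isUnit (hsq p ?_)
      exact mul_dvd_mul_left p hdvd
    obtain ⟨u, v, huv⟩ := id hpb
    refine ⟨s * (u * p) + t * (v * b), hpb.mul_dvd ?_ ?_⟩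
    · have : (s * (u * p) + t * (v * b)) ^ 2 - a =
          (t ^ 2 - a) + p * (u * (s - t)) * (s * (u * p) + t * (v * b) + t) := by
        have hv : v * b = 1 - u * p := by linear_combination huv
        rw [hv]; ring
      rw [this]
      exact dvd_add ht ⟨u * (s - t) * (s * (u * p) + t * (v * b) + t), by ring⟩
    · have : (s * (u * p) + t * (v * b)) ^ 2 - a =
          (s ^ 2 - a) + b * (v * (t - s)) * (s * (u * p) + t * (v * b) + s) := by
        have hv : u * p = 1 - v * b := by linear_combination huv
        rw [hv]; ring
      rw [this]
      exact dvd_add hs ⟨v * (t - s) * (s * (u * p) + t * (v * b) + s), by ring⟩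

variable (hi : ∃ i : M, i ^ 2 = -1)
include hi

/-- Legendre descent: over the affine line, an unramified symbol is constant. -/
theorem exists_const_of_isUnramified (h2 : (2 : M) ≠ 0) (n : ℕ) (a b : M[X]) (ha : a ≠ 0)
    (hb : b ≠ 0) (hn : a.natDegree + b.natDegree ≤ n) (h : IsUnramified a b) :
    ∃ c d : M, c ≠ 0 ∧ d ≠ 0 ∧ ∀ (F : Type _) [Field F] (θ : M[X] →+* F),
      Function.Injective θ → (IsNormForm (θ a) (θ b) ↔ IsNormForm (θ (C c)) (θ (C d))) := by
  have hi' : ∃ i : M[X], i ^ 2 = -1 := by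
    obtain ⟨i, hi⟩ := hi
    exact ⟨C i, by rw [← Polynomial.C_pow, hi]; simp⟩
  have hθ2 : ∀ {F : Type _} [Field F] (θ : M[X] →+* F), (2 : F) ≠ 0 := by
    intro F _ θ
    have := (map_ne_zero (θ.comp C)).2 h2
    rwa [map_ofNat] at this
  induction n using Nat.strong_induction_on generalizing a b with
  | _ n ih =>
  wlog hab : a.natDegree ≤ b.natDegree generalizing a b
  · obtain ⟨c, d, hc, hd, hcd⟩ := this b a hb ha (by lia) (fun p _ => (h p).symm) (by lia)
    refine ⟨c, d, hc, hd, fun F _ θ hθ => ?_⟩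
    rw [← hcd F θ hθ]
    exact IsNormForm.symm_iff (hθ2 θ) ((map_ne_zero_iff θ hθ).2 ha) ((map_ne_zero_iff θ hθ).2 hb)
  by_cases hb0 : b.natDegree = 0
  · rw [hb0, Nat.le_zero] at hab
    obtain ⟨d, rfl⟩ := natDegree_eq_zero.1 hb0
    obtain ⟨c, rfl⟩ := natDegree_eq_zero.1 hab
    exact ⟨c, d, by rintro rfl; simp at ha, by rintro rfl; simp at hb, fun _ _ _ _ => Iff.rfl⟩
  by_cases hsq : Squarefree b
  · obtain ⟨s, hs⟩ := exists_dvd_sq_sub_of_squarefree a b hb hsq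
      fun p hp hpb => exists_dvd_sq_sub_of_irreducible ha hb hsq h hp hpb
    obtain ⟨s, hsdeg, b', hb'⟩ : ∃ s : M[X], s.natDegree < b.natDegree ∧ b ∣ s ^ 2 - a := by
      refine ⟨s % b, natDegree_mod_lt s hb0, ?_⟩
      have : (s % b) ^ 2 - a = (s ^ 2 - a) - b * ((s / b) * (s + s % b)) := by
        linear_combination (s + s % b) * (EuclideanDomain.div_add_mod s b)
      rw [this]
      exact dvd_sub hs (dvd_mul_right _ _)
    by_cases hb'0 : b' = 0
    · have hs0 : a = s ^ 2 := by rw [hb'0] at hb'; linear_combination -hb'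
      have hs1 : s ≠ 0 := by
        rintro rfl
        exact ha (by simpa using hs0)
      refine ⟨1, 1, one_ne_zero, one_ne_zero, fun F _ θ hθ => ?_⟩
      rw [hs0, map_pow]
      exact iff_of_true (IsNormForm.of_sq (hθ2 θ) ((map_ne_zero_iff θ hθ).2 hs1) _)
        ⟨1, 0, by simp⟩
    · have hbb' : b * b' ≠ 0 := mul_ne_zero hb hb'0
      have hdeg : b'.natDegree < b.natDegree := by
        have h3 : (b * b').natDegree ≤ max (2 * s.natDegree) a.natDegree := by
          rw [← hb', ← natDegree_pow]
          exact natDegree_sub_le _ _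
        rw [natDegree_mul hb hb'0] at h3
        rcases le_max_iff.1 h3 with h3 | h3 <;> lia
      obtain ⟨c, d, hc, hd, hcd⟩ := ih (a.natDegree + b'.natDegree) (by lia) a b' ha hb'0 le_rfl
        fun p _ => Tame.of_mul ha hb hb'0
          (tame_norm hi' ha hbb' (x := s) (y := 1) (by rw [← hb']; ring)) (h p)
      refine ⟨c, d, hc, hd, fun F _ θ hθ => ?_⟩
      rw [← hcd F θ hθ]
      refine IsNormForm.mul_iff ((map_ne_zero_iff θ hθ).2 hb) ((map_ne_zero_iff θ hθ).2 hb'0)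
        ⟨θ s, 1, ?_⟩
      rw [← map_mul, ← hb']
      simp
  · obtain ⟨g, b', hgb, hg⟩ : ∃ g b' : M[X], b = g ^ 2 * b' ∧ ¬ IsUnit g := by
      unfold Squarefree at hsq
      push Not at hsq
      obtain ⟨g, ⟨b', hgb⟩, hg⟩ := hsq
      exact ⟨g, b', by rw [hgb]; ring, hg⟩
    have hg0 : g ≠ 0 := by
      rintro rfl
      exact hb (by simpa using hgb)
    have hb'0 : b' ≠ 0 := by
      rintro rfl
      exact hb (by simpa using hgb)
    have hg2 : g ^ 2 ≠ 0 := pow_ne_zero _ hg0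
    have hgdeg : 0 < g.natDegree := by
      rw [Nat.pos_iff_ne_zero]
      intro hg1
      obtain ⟨e, rfl⟩ := natDegree_eq_zero.1 hg1
      exact hg (isUnit_C.2 (isUnit_iff_ne_zero.2 (by rintro rfl; simp at hg0)))
    have hdeg : b.natDegree = 2 * g.natDegree + b'.natDegree := by
      rw [hgb, natDegree_mul hg2 hb'0, natDegree_pow]
    obtain ⟨c, d, hc, hd, hcd⟩ := ih (a.natDegree + b'.natDegree) (by lia) a b' ha hb'0 le_rfl
      fun p _ => Tame.of_mul ha hg2 hb'0 (hgb ▸ h p) (tame_sq hg0)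
    refine ⟨c, d, hc, hd, fun F _ θ hθ => ?_⟩
    rw [← hcd F θ hθ, hgb, map_mul, map_pow]
    exact IsNormForm.sq_mul_iff ((map_ne_zero_iff θ hθ).2 hg0)

end Descent

section Specialization

open PowerSeries

variable {M : Type*} [Field M]

/-- Norm forms with unit coefficients over Laurent series specialize to the residue field. -/
lemma isNormForm_constantCoeff (h2 : (2 : M) ≠ 0) {a b : M⟦X⟧}
    (ha : constantCoeff a ≠ 0)
    (h : IsNormForm (algebraMap M⟦X⟧ (LaurentSeries M) a) (algebraMap M⟦X⟧ (LaurentSeries M) b)) :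
    IsNormForm (constantCoeff a) (constantCoeff b) := by
  have key : ∀ (n : ℕ) (x y z : M⟦X⟧), constantCoeff z ≠ 0 →
      b * (PowerSeries.X ^ n * z) ^ 2 = x ^ 2 - a * y ^ 2 →
      IsNormForm (constantCoeff a) (constantCoeff b) := by
    intro n
    induction n with
    | zero =>
      intro x y z hz h
      have h0 := congrArg PowerSeries.constantCoeff h
      simp only [map_mul, map_sub, map_pow, pow_zero, one_mul] at h0
      refine ⟨constantCoeff x / constantCoeff z, constantCoeff y / constantCoeff z, ?_⟩
      field_simp
      exact h0
    | succ n ih =>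
      intro x y z hz h
      have h0 := congrArg PowerSeries.constantCoeff h
      simp only [map_mul, map_sub, map_pow, PowerSeries.constantCoeff_X] at h0
      by_cases hy : constantCoeff y = 0
      · have hx : constantCoeff x = 0 := by
          rw [hy] at h0
          simpa using h0.symm
        obtain ⟨x', rfl⟩ := X_dvd_iff.2 hx
        obtain ⟨y', rfl⟩ := X_dvd_iff.2 hy
        refine ih x' y' z hz (mul_left_cancel₀ (pow_ne_zero 2 (X_ne_zero (R := M))) ?_)
        linear_combination h
      · have hsq : constantCoeff a = (constantCoeff x / constantCoeff y) ^ 2 := by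
          field_simp
          linear_combination h0
        rw [hsq]
        refine IsNormForm.of_sq h2 ?_ _
        rintro h3
        rw [h3] at hsq
        exact ha (by simpa using hsq)
  obtain ⟨x, y, h⟩ := h
  obtain ⟨x₁, x₂, hx₂, rfl⟩ := IsFractionRing.div_surjective (A := M⟦X⟧) x
  obtain ⟨y₁, y₂, hy₂, rfl⟩ := IsFractionRing.div_surjective (A := M⟦X⟧) y
  have hx := nonZeroDivisors.ne_zero hx₂
  have hy := nonZeroDivisors.ne_zero hy₂
  obtain ⟨n, z, hz, hxy⟩ := WfDvdMonoid.max_power_factor (mul_ne_zero hx hy)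
    (PowerSeries.X_prime (R := M)).irreducible
  refine key n (x₁ * y₂) (x₂ * y₁) z (fun h => hz (X_dvd_iff.2 h)) ?_
  rw [← hxy]
  apply IsFractionRing.injective M⟦X⟧ (LaurentSeries M)
  have hx' := (map_ne_zero_iff _ (IsFractionRing.injective M⟦X⟧ (LaurentSeries M))).2 hx
  have hy' := (map_ne_zero_iff _ (IsFractionRing.injective M⟦X⟧ (LaurentSeries M))).2 hy
  simp only [map_mul, map_sub, map_pow]
  rw [h]
  field_simp

lemma exists_sq_eq_of_constantCoeff (h2 : (2 : M) ≠ 0) {a : M⟦X⟧} {r : M} (hr : r ≠ 0)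
    (ha : constantCoeff a = r ^ 2) : ∃ s : M⟦X⟧, a = s ^ 2 := by
  have hmem : ∀ f : M⟦X⟧, f ∈ Ideal.span {(PowerSeries.X : M⟦X⟧)} ↔ constantCoeff f = 0 := by
    intro f
    rw [Ideal.mem_span_singleton, X_dvd_iff]
  obtain ⟨s, hs, -⟩ := HenselianRing.is_henselian (I := Ideal.span {(PowerSeries.X : M⟦X⟧)})
    (Polynomial.X ^ 2 - Polynomial.C a) (Polynomial.monic_X_pow_sub_C a two_ne_zero)
    (PowerSeries.C r) (by simp [hmem, ha])
    (by
      refine IsUnit.map _ (isUnit_iff_constantCoeff.2 ?_)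
      have h3 : (1 : M) + 1 ≠ 0 := by rwa [one_add_one_eq_two]
      simp [h3, hr])
  refine ⟨s, ?_⟩
  simp only [Polynomial.IsRoot.def, Polynomial.eval_sub, Polynomial.eval_pow, Polynomial.eval_X,
    Polynomial.eval_C] at hs
  linear_combination -hs

open Polynomial in
/-- An unramified symbol over the affine line which splits at `1` splits at `0`. -/
theorem isNormForm_eval_zero (h2 : (2 : M) ≠ 0) (hi : ∃ i : M, i ^ 2 = -1) {a b : M[X]}
    (h : IsUnramified a b) (ha₀ : a.eval 0 ≠ 0) (hb₀ : b.eval 0 ≠ 0)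
    {r : M} (hr : r ≠ 0) (ha₁ : a.eval 1 = r ^ 2) : IsNormForm (a.eval 0) (b.eval 0) := by
  let ι : M[X] →+* LaurentSeries M :=
    (algebraMap M⟦X⟧ (LaurentSeries M)).comp Polynomial.coeToPowerSeries.ringHom
  have hι : ∀ f : M[X], ι f = algebraMap M⟦X⟧ (LaurentSeries M) (f : M⟦X⟧) := fun f => rfl
  have hinj : Function.Injective ι :=
    (IsFractionRing.injective M⟦X⟧ (LaurentSeries M)).comp (Polynomial.coe_injective M)
  let θ : M[X] →+* LaurentSeries M := ι.comp (Polynomial.taylorAlgHom 1 : M[X] →ₐ[M] M[X])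
  have hθ : ∀ f : M[X], θ f = ι (Polynomial.taylor 1 f) := fun f => rfl
  have hθinj : Function.Injective θ := hinj.comp (Polynomial.taylor_injective 1)
  have hcc : ∀ f : M[X], constantCoeff (f : M⟦X⟧) = f.eval 0 := by
    intro f
    rw [← Polynomial.coeff_zero_eq_eval_zero, ← PowerSeries.coeff_zero_eq_constantCoeff_apply,
      Polynomial.coeff_coe]
  obtain ⟨c, d, hc, hd, hcd⟩ := exists_const_of_isUnramified hi h2 _ a b
    (by rintro rfl; simp at ha₀) (by rintro rfl; simp at hb₀) le_rfl h
  have hsplit : IsNormForm (θ a) (θ b) := by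
    obtain ⟨s, hs⟩ := exists_sq_eq_of_constantCoeff (a := (Polynomial.taylor 1 a : M⟦X⟧)) h2 hr
      (by rw [hcc, ← Polynomial.coeff_zero_eq_eval_zero, Polynomial.taylor_coeff_zero, ha₁])
    have hs0 : s ≠ 0 := by
      rintro rfl
      have h3 := congrArg PowerSeries.constantCoeff hs
      rw [hcc, ← Polynomial.coeff_zero_eq_eval_zero, Polynomial.taylor_coeff_zero, ha₁] at h3
      exact hr (by simpa using h3)
    rw [hθ a, hι, hs, map_pow]
    refine IsNormForm.of_sq ?_ ?_ _
    · have := (map_ne_zero (ι.comp Polynomial.C)).2 h2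
      rwa [map_ofNat] at this
    · exact (map_ne_zero_iff _ (IsFractionRing.injective M⟦X⟧ (LaurentSeries M))).2 hs0
  have hconst : IsNormForm c d := by
    have h3 := (hcd _ θ hθinj).1 hsplit
    rw [hθ, hθ, Polynomial.taylor_C, Polynomial.taylor_C, hι, hι] at h3
    simpa using isNormForm_constantCoeff h2 (by simpa using hc) h3
  have h4 := (hcd _ ι hinj).2 (hconst.map (ι.comp Polynomial.C))
  rw [hι, hι] at h4
  have h5 := isNormForm_constantCoeff h2 (by rwa [hcc]) h4
  rwa [hcc, hcc] at h5

end Specialization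

section Retract

universe u

variable {k K : Type u} [Field k] [Field K] [Algebra k K]

/-- Finitely many elements of a retract rational field are represented, up to a common factor,
by polynomials, compatibly with all points of the field. -/
lemma IsRetractRational.exists_polynomial (h : IsRetractRational k K) (S : Finset K) :
    ∃ (n : ℕ) (F : Type u) (_ : Field F) (ι : MvPolynomial (Fin n) k →+* F) (Φ : K →+* F) (c : F)
      (P : K → MvPolynomial (Fin n) k), Function.Injective ι ∧ c ≠ 0 ∧
      (∀ x ∈ S, ι (P x) = c * Φ x) ∧ ∀ (M : Type u) [Field M] (g : K →+* M),
        ∃ (m : Fin n → M) (e : M), e ≠ 0 ∧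
          ∀ x ∈ S, eval₂Hom (g.comp (algebraMap k K)) m (P x) = e * g x := by
  obtain ⟨A, hA, n, f, hf, φ, ψ, hψφ⟩ := h
  have hdom : IsDomain (Localization.Away f) :=
    IsLocalization.isDomain_localization (powers_le_nonZeroDivisors_of_noZeroDivisors hf)
  let B := Localization.Away f
  have hψφ' : ∀ x, ψ (φ x) = x := fun x => DFunLike.congr_fun hψφ x
  have hφ : Function.Injective φ := Function.LeftInverse.injective hψφ'
  have hBF : Function.Injective (algebraMap B (FractionRing B)) := IsFractionRing.injective _ _
  have hj : Function.Injective ((algebraMap B (FractionRing B)).comp (φ : A →+* B)) := hBF.comp hφ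
  let Φ : K →+* FractionRing B := IsFractionRing.lift hj
  have hΦ : ∀ y : A, Φ (algebraMap A K y) = algebraMap B (FractionRing B) (φ y) := fun y =>
    IsFractionRing.lift_algebraMap hj y
  obtain ⟨q, hq⟩ := IsLocalization.exist_integer_multiples_of_finset (nonZeroDivisors A) S
  have hq' : ∀ x : K, ∃ y : A, x ∈ S → algebraMap A K y = algebraMap A K q * x := by
    intro x
    by_cases hx : x ∈ S
    · obtain ⟨y, hy⟩ := hq x hx
      exact ⟨y, fun _ => by rw [hy, Algebra.smul_def]⟩
    · exact ⟨0, fun h => absurd h hx⟩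
  choose y hy using hq'
  classical
  obtain ⟨b, hb⟩ := IsLocalization.exist_integer_multiples_of_finset (Submonoid.powers f)
    (S.image fun x => φ (y x))
  have hb' : ∀ x : K, ∃ p : MvPolynomial (Fin n) k, x ∈ S →
      algebraMap _ B p = algebraMap _ B (b : MvPolynomial (Fin n) k) * φ (y x) := by
    intro x
    by_cases hx : x ∈ S
    · obtain ⟨p, hp⟩ := hb _ (Finset.mem_image_of_mem _ hx)
      exact ⟨p, fun _ => by rw [hp, Algebra.smul_def]⟩
    · exact ⟨0, fun h => absurd h hx⟩
  choose P hP using hb'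
  have hbu : IsUnit (algebraMap _ B (b : MvPolynomial (Fin n) k)) :=
    IsLocalization.map_units B b
  have hq0 : algebraMap A K q ≠ 0 :=
    (map_ne_zero_iff _ (IsFractionRing.injective A K)).2 (nonZeroDivisors.ne_zero q.2)
  refine ⟨n, FractionRing B, inferInstance, (algebraMap B (FractionRing B)).comp (algebraMap _ B),
    Φ, algebraMap B _ (algebraMap _ B (b : MvPolynomial (Fin n) k)) * Φ (algebraMap A K q), P,
    hBF.comp (IsLocalization.injective B (powers_le_nonZeroDivisors_of_noZeroDivisors hf)),
    mul_ne_zero ((map_ne_zero_iff _ hBF).2 hbu.ne_zero) ((map_ne_zero Φ).2 hq0), ?_, ?_⟩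
  · intro x hx
    rw [RingHom.comp_apply, hP x hx, map_mul, ← hΦ, hy x hx, map_mul, mul_assoc]
  · intro M _ g
    let γ : B →+* M := (g.comp (algebraMap A K)).comp (ψ : B →+* A)
    have hγ : ∀ x : B, γ x = g (algebraMap A K (ψ x)) := fun x => rfl
    have hev : eval₂Hom (g.comp (algebraMap k K))
        (fun i => γ (algebraMap (MvPolynomial (Fin n) k) B (X i))) =
        γ.comp (algebraMap _ B) := by
      refine MvPolynomial.ringHom_ext (fun c => ?_) (fun i => by simp)
      rw [RingHom.comp_apply, hγ, ← MvPolynomial.algebraMap_eq,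
        ← IsScalarTower.algebraMap_apply k (MvPolynomial (Fin n) k) B, AlgHom.commutes,
        ← IsScalarTower.algebraMap_apply k A K, MvPolynomial.algebraMap_eq]
      simp
    refine ⟨fun i => γ (algebraMap (MvPolynomial (Fin n) k) B (X i)),
      γ (algebraMap _ B (b : MvPolynomial (Fin n) k)) * g (algebraMap A K q),
      mul_ne_zero (hbu.map γ).ne_zero ((map_ne_zero g).2 hq0), fun x hx => ?_⟩
    rw [hev, RingHom.comp_apply, hP x hx, map_mul, hγ (φ _), hψφ', hy x hx, map_mul, mul_assoc]

open AngularComponent in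
/-- The class `(a, z - 1)` on a retract rational field takes the same value at any two points. -/
theorem IsRetractRational.isNormForm (h : IsRetractRational k K) {M : Type u} [Field M]
    (h2 : (2 : M) ≠ 0) (hi : ∃ i : M, i ^ 2 = -1) (g₀ g₁ : K →+* M)
    (hg : g₀.comp (algebraMap k K) = g₁.comp (algebraMap k K)) {a z u v r s : K} (ha : a ≠ 0)
    (hz : z ≠ 0) (hz1 : z - 1 ≠ 0) (hza : z - a ≠ 0) (huv : z = u ^ 2 - a * v ^ 2)
    (hrs : (z - 1) * (z - a) = r ^ 2 - a * s ^ 2) {w : M} (hw : g₁ a = w ^ 2) :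
    IsNormForm (g₀ a) (g₀ z - 1) := by
  classical
  obtain ⟨n, F, _, ι, Φ, c, P, hι, hc, hP, hpt⟩ := h.exists_polynomial {1, a, z, u, v, r, s}
  obtain ⟨m₀, e₀, he₀, hm₀⟩ := hpt M g₀
  obtain ⟨m₁, e₁, he₁, hm₁⟩ := hpt M g₁
  rw [← hg] at hm₁
  set κ := g₀.comp (algebraMap k K)
  let ev : MvPolynomial (Fin n) k →+* Polynomial M := eval₂Hom (Polynomial.C.comp κ)
    fun i => Polynomial.C (m₀ i) + Polynomial.X * Polynomial.C (m₁ i - m₀ i)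
  have hev₀ : ∀ p, (ev p).eval 0 = eval₂Hom κ m₀ p := by
    have : (Polynomial.evalRingHom 0).comp ev = eval₂Hom κ m₀ :=
      MvPolynomial.ringHom_ext (fun c => by simp [ev]) (fun i => by simp [ev])
    exact fun p => DFunLike.congr_fun this p
  have hev₁ : ∀ p, (ev p).eval 1 = eval₂Hom κ m₁ p := by
    have : (Polynomial.evalRingHom 1).comp ev = eval₂Hom κ m₁ :=
      MvPolynomial.ringHom_ext (fun c => by simp [ev]) (fun i => by simp [ev])
    exact fun p => DFunLike.congr_fun this p
  simp only [Finset.mem_insert, Finset.mem_singleton, forall_eq_or_imp, forall_eq, map_one,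
    mul_one] at hP hm₀ hm₁
  obtain ⟨P1, Pa, Pz, Pu, Pv, Pr, Ps⟩ := hP
  obtain ⟨m1, ma, mz, -⟩ := hm₀
  obtain ⟨n1, na, -⟩ := hm₁
  have hΦ1 : Φ z = Φ u ^ 2 - Φ a * Φ v ^ 2 := by simpa using congrArg Φ huv
  have hΦ2 : (Φ z - 1) * (Φ z - Φ a) = Φ r ^ 2 - Φ a * Φ s ^ 2 := by
    simpa using congrArg Φ hrs
  have id1 : P 1 ^ 2 * (P z * P 1) = (P 1 * P u) ^ 2 - (P a * P 1) * P v ^ 2 := by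
    apply hι
    simp only [map_mul, map_sub, map_pow, P1, Pa, Pz, Pu, Pv, hΦ1]
    ring
  have id2 : (P z * P 1 - P 1 ^ 2) * (P z * P 1 - P a * P 1) =
      (P 1 * P r) ^ 2 - (P a * P 1) * P s ^ 2 := by
    apply hι
    simp only [map_mul, map_sub, map_pow, P1, Pa, Pz, Pr, Ps]
    linear_combination c ^ 4 * hΦ2
  have id1' : ev (P 1) ^ 2 * ev (P z * P 1) =
      (ev (P 1) * ev (P u)) ^ 2 - ev (P a * P 1) * ev (P v) ^ 2 := by
    simp only [← map_mul, ← map_pow, ← map_sub]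
    exact congrArg ev id1
  have id2' : (ev (P z * P 1) - ev (P 1) ^ 2) * (ev (P z * P 1) - ev (P a * P 1)) =
      (ev (P 1) * ev (P r)) ^ 2 - ev (P a * P 1) * ev (P s) ^ 2 := by
    simp only [← map_mul, ← map_pow, ← map_sub]
    exact congrArg ev id2
  have ev1 : (ev (P 1)).eval 0 = e₀ := by rw [hev₀, m1]
  have eva : (ev (P a * P 1)).eval 0 = e₀ ^ 2 * g₀ a := by
    rw [hev₀, map_mul, m1, ma]; ring
  have evz : (ev (P z * P 1)).eval 0 = e₀ ^ 2 * g₀ z := by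
    rw [hev₀, map_mul, m1, mz]; ring
  have eva₁ : (ev (P a * P 1)).eval 1 = (e₁ * w) ^ 2 := by
    rw [hev₁, map_mul, n1, na, hw]; ring
  have hw0 : w ≠ 0 := by
    rintro rfl
    exact (map_ne_zero g₁).2 ha (by simpa using hw)
  have he2 : e₀ ^ 2 ≠ 0 := pow_ne_zero _ he₀
  set α := ev (P a * P 1)
  set γ := ev (P z * P 1)
  set q := ev (P 1)
  have evd : (γ - q ^ 2).eval 0 = e₀ ^ 2 * (g₀ z - 1) := by
    rw [Polynomial.eval_sub, Polynomial.eval_pow, evz, ev1]; ring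
  have eve : (γ - α).eval 0 = e₀ ^ 2 * g₀ (z - a) := by
    rw [Polynomial.eval_sub, eva, evz, map_sub]; ring
  have ne_zero : ∀ {p : Polynomial M} {x : M}, p.eval 0 = x → x ≠ 0 → p ≠ 0 := by
    rintro p x hp hx rfl
    exact hx (by simpa using hp.symm)
  have hga := mul_ne_zero he2 ((map_ne_zero g₀).2 ha)
  have hgd : e₀ ^ 2 * (g₀ z - 1) ≠ 0 := by
    have := mul_ne_zero he2 ((map_ne_zero g₀).2 hz1)
    rwa [map_sub, map_one] at this
  have hα : α ≠ 0 := ne_zero eva hga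
  have hγ : γ ≠ 0 := ne_zero evz (mul_ne_zero he2 ((map_ne_zero g₀).2 hz))
  have hq : q ≠ 0 := ne_zero ev1 he₀
  have hδ : γ - q ^ 2 ≠ 0 := ne_zero evd hgd
  have hε : γ - α ≠ 0 := ne_zero eve (mul_ne_zero he2 ((map_ne_zero g₀).2 hza))
  have hi' : ∃ i : Polynomial M, i ^ 2 = -1 := by
    obtain ⟨i, hi⟩ := hi
    exact ⟨Polynomial.C i, by rw [← Polynomial.C_pow, hi]; simp⟩
  have hunram : IsUnramified α (γ - q ^ 2) := by
    intro p _
    have hq2 := pow_ne_zero 2 hq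
    exact tame_sub_sq hi' hα hγ hq hδ hε
      (Tame.of_mul hα hq2 hγ (tame_norm hi' hα (mul_ne_zero hq2 hγ) id1') (tame_sq hq))
      (tame_norm hi' hα (mul_ne_zero hδ hε) id2')
  have := isNormForm_eval_zero h2 hi hunram (by rwa [eva]) (by rwa [evd]) (mul_ne_zero he₁ hw0) eva₁
  rw [eva, evd] at this
  exact (IsNormForm.sq_mul_left_iff he₀).1 ((IsNormForm.sq_mul_iff he₀).1 this)

end Retract

section Descent

/-- In a factorial ring with an involution, a unit which is a norm from the fraction field is the
norm of a unit. -/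
lemma exists_isUnit_mul_map_eq {R : Type*} [CommRing R] [IsDomain R] [UniqueFactorizationMonoid R]
    (τ : R →+* R) (hτ : ∀ x, τ (τ x) = x) {β : R} (hβ : IsUnit β) (P : R) (hP : P ≠ 0) :
    ∀ Q : R, Q ≠ 0 → P * τ P = β * (Q * τ Q) → ∃ w, IsUnit w ∧ w * τ w = β := by
  have hinj : Function.Injective τ := Function.LeftInverse.injective hτ
  have h0 : ∀ {x : R}, x ≠ 0 → τ x ≠ 0 := fun hx => (map_ne_zero_iff τ hinj).2 hx
  induction P using UniqueFactorizationMonoid.induction_on_prime with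
  | h₁ => exact absurd rfl hP
  | h₂ P hPu =>
    intro Q _ h
    have hQu : IsUnit Q := isUnit_of_dvd_unit ⟨β * τ Q, by rw [h]; ring⟩ (hPu.mul (hPu.map τ))
    obtain ⟨v, hv⟩ := hQu.exists_right_inv
    have hv' : τ Q * τ v = 1 := by rw [← map_mul, hv, map_one]
    refine ⟨P * v, hPu.mul (isUnit_of_dvd_unit ⟨Q, by rw [mul_comm, hv]⟩ isUnit_one), ?_⟩
    calc P * v * τ (P * v) = P * τ P * v * τ v := by rw [map_mul]; ring
      _ = β * (Q * v) * (τ Q * τ v) := by rw [h]; ring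
      _ = β := by rw [hv, hv']; ring
  | h₃ P p hP' hp ih =>
    intro Q hQ h
    have hpp : p * τ p ≠ 0 := mul_ne_zero hp.ne_zero (h0 hp.ne_zero)
    rw [map_mul] at h
    have hdvd : p ∣ Q * τ Q := by
      refine (hp.dvd_or_dvd (⟨P * (τ p * τ P), by rw [← h]; ring⟩ : p ∣ β * (Q * τ Q))).resolve_left
        fun hpβ => hp.not_isUnit (isUnit_of_dvd_unit hpβ hβ)
    rcases hp.dvd_or_dvd hdvd with ⟨Q', rfl⟩ | ⟨Q', hQ'⟩
    · refine ih hP' Q' (right_ne_zero_of_mul hQ) (mul_left_cancel₀ hpp ?_)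
      rw [map_mul] at h
      linear_combination h
    · have hQ2 : Q = τ p * τ Q' := by rw [← map_mul, ← hQ', hτ]
      have hQ0 : Q' ≠ 0 := by
        rintro rfl
        exact hQ (by simpa using hQ2)
      refine ih hP' Q' hQ0 (mul_left_cancel₀ hpp ?_)
      rw [hQ', hQ2] at h
      linear_combination h

lemma exists_eq_pow_mul_of_dvd {R : Type*} [CommRing R] [IsDomain R] {p : R} (hp : Prime p)
    {E : R} (n : ℕ) : ∀ {P : R}, P ∣ p ^ n * E → ∃ i P', P = p ^ i * P' ∧ P' ∣ E := by
  induction n with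
  | zero => exact fun {P} h => ⟨0, P, by simp, by simpa using h⟩
  | succ n ih =>
    rintro P ⟨c, hc⟩
    rcases hp.dvd_or_dvd (⟨p ^ n * E, by rw [← hc]; ring⟩ : p ∣ P * c) with ⟨P', rfl⟩ | ⟨c', rfl⟩
    · obtain ⟨i, P'', rfl, h⟩ := ih (P := P') ⟨c, mul_left_cancel₀ hp.ne_zero (by
        linear_combination hc)⟩
      exact ⟨i + 1, P'', by ring, h⟩
    · exact ih ⟨c', mul_left_cancel₀ hp.ne_zero (by linear_combination hc)⟩

lemma MvPolynomial.prime_X_sub {σ Ω : Type*} [Field Ω] (i : σ) (g : MvPolynomial σ Ω)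
    (s : MvPolynomial σ Ω →ₐ[Ω] MvPolynomial σ Ω) (hsi : s (X i) = g) (hsg : s g = g)
    (hs : ∀ j ≠ i, s (X j) = X j) (h0 : X i ≠ g) : Prime (X i - g) := by
  have key : ∀ f, X i - g ∣ f - s f := by
    intro f
    induction f using MvPolynomial.induction_on with
    | C c => simp [← MvPolynomial.algebraMap_eq]
    | add p q hp hq =>
      have := dvd_add hp hq
      rwa [map_add, add_sub_add_comm]
    | mul_X p j hp =>
      have h' : X i - g ∣ X j - s (X j) := by
        by_cases hj : j = i
        · rw [hj, hsi]
        · simp [hs j hj]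
      have := dvd_add (hp.mul_right (X j)) (h'.mul_left (s p))
      rw [map_mul]
      convert this using 1
      ring
  have hdvd : ∀ f, X i - g ∣ f ↔ s f = 0 := by
    intro f
    constructor
    · rintro ⟨c, rfl⟩
      simp [hsi, hsg]
    · intro h
      simpa [h] using key f
  refine ⟨sub_ne_zero.2 h0, fun h => ?_, fun a b h => ?_⟩
  · simpa using (hdvd 1).1 h.dvd
  · rw [hdvd, hdvd, ← mul_eq_zero, ← map_mul, ← hdvd]
    exact h

end Descent

section Involution

variable (Ω : Type*) [Field Ω]

/-- The product of the polynomials which the involution requires to be invertible. -/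
def discriminant : MvPolynomial (Fin 4) Ω :=
  X 1 * (X 2 * (X 3 * ((X 3 - 1) * (X 3 - X 0 ^ 2))))

lemma X_ne_of_ne {g : MvPolynomial (Fin 4) Ω} (v : Fin 4 → Ω) (h : v 3 ≠ eval v g) : X 3 ≠ g := by
  rintro rfl
  simp at h

lemma prime_X_three_sub_one : Prime (X 3 - 1 : MvPolynomial (Fin 4) Ω) := by
  refine MvPolynomial.prime_X_sub 3 1 (aeval ![X 0, X 1, X 2, 1]) (by simp) (by simp) ?_
    (X_ne_of_ne Ω 0 (by simp))
  intro j hj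
  fin_cases j <;> simp at hj ⊢

lemma prime_X_three_sub_sq : Prime (X 3 - X 0 ^ 2 : MvPolynomial (Fin 4) Ω) := by
  refine MvPolynomial.prime_X_sub 3 _ (aeval ![X 0, X 1, X 2, X 0 ^ 2]) (by simp) (by simp) ?_
    (X_ne_of_ne Ω ![0, 0, 0, 1] (by simp))
  intro j hj
  fin_cases j <;> simp at hj ⊢

lemma discriminant_ne_zero : discriminant Ω ≠ 0 :=
  mul_ne_zero (X_ne_zero _) (mul_ne_zero (X_ne_zero _) (mul_ne_zero (X_ne_zero _)
    (mul_ne_zero (prime_X_three_sub_one Ω).ne_zero (prime_X_three_sub_sq Ω).ne_zero)))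

/-- The coordinate ring of the open set where the involution is defined. -/
abbrev CoordRing := Localization.Away (discriminant Ω)

instance : IsDomain (CoordRing Ω) :=
  IsLocalization.isDomain_localization
    (powers_le_nonZeroDivisors_of_noZeroDivisors (discriminant_ne_zero Ω))

/-- The inclusion of the polynomial ring. -/
def toCoordRing : MvPolynomial (Fin 4) Ω →ₐ[Ω] CoordRing Ω :=
  IsScalarTower.toAlgHom Ω (MvPolynomial (Fin 4) Ω) (CoordRing Ω)

lemma isUnit_toCoordRing {x : MvPolynomial (Fin 4) Ω} (h : x ∣ discriminant Ω) :
    IsUnit (toCoordRing Ω x) :=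
  isUnit_of_dvd_unit (map_dvd (toCoordRing Ω) h) (IsLocalization.Away.algebraMap_isUnit _)

lemma toCoordRing_injective : Function.Injective (toCoordRing Ω) :=
  IsLocalization.injective (CoordRing Ω)
    (powers_le_nonZeroDivisors_of_noZeroDivisors (discriminant_ne_zero Ω))

lemma isUnit_X_one : IsUnit (toCoordRing Ω (X 1)) := isUnit_toCoordRing Ω ⟨_, rfl⟩

lemma isUnit_X_two : IsUnit (toCoordRing Ω (X 2)) :=
  isUnit_toCoordRing Ω (dvd_mul_of_dvd_right ⟨_, rfl⟩ _)

lemma isUnit_X_three : IsUnit (toCoordRing Ω (X 3)) :=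
  isUnit_toCoordRing Ω (dvd_mul_of_dvd_right (dvd_mul_of_dvd_right ⟨_, rfl⟩ _) _)

lemma isUnit_X_three_sub_one : IsUnit (toCoordRing Ω (X 3 - 1)) :=
  isUnit_toCoordRing Ω (dvd_mul_of_dvd_right (dvd_mul_of_dvd_right
    (dvd_mul_of_dvd_right ⟨_, rfl⟩ _) _) _)

lemma isUnit_X_three_sub_sq : IsUnit (toCoordRing Ω (X 3 - X 0 ^ 2)) :=
  isUnit_toCoordRing Ω (dvd_mul_of_dvd_right (dvd_mul_of_dvd_right
    (dvd_mul_of_dvd_right (dvd_mul_left _ _) _) _) _)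

/-- The involution on polynomials. -/
def polyInvolution : MvPolynomial (Fin 4) Ω →ₐ[Ω] CoordRing Ω :=
  aeval ![-toCoordRing Ω (X 0), toCoordRing Ω (X 3) * Ring.inverse (toCoordRing Ω (X 1)),
    toCoordRing Ω ((X 3 - 1) * (X 3 - X 0 ^ 2)) * Ring.inverse (toCoordRing Ω (X 2)),
    toCoordRing Ω (X 3)]

lemma polyInvolution_X_zero : polyInvolution Ω (X 0) = -toCoordRing Ω (X 0) := by
  simp [polyInvolution]

lemma polyInvolution_X_three : polyInvolution Ω (X 3) = toCoordRing Ω (X 3) := by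
  simp [polyInvolution]

lemma polyInvolution_X_one_mul :
    toCoordRing Ω (X 1) * polyInvolution Ω (X 1) = toCoordRing Ω (X 3) := by
  have : polyInvolution Ω (X 1) =
      toCoordRing Ω (X 3) * Ring.inverse (toCoordRing Ω (X 1)) := by simp [polyInvolution]
  rw [this, mul_left_comm, Ring.mul_inverse_cancel _ (isUnit_X_one Ω), mul_one]

lemma polyInvolution_X_two_mul :
    toCoordRing Ω (X 2) * polyInvolution Ω (X 2) =
      toCoordRing Ω ((X 3 - 1) * (X 3 - X 0 ^ 2)) := by
  have : polyInvolution Ω (X 2) = toCoordRing Ω ((X 3 - 1) * (X 3 - X 0 ^ 2)) *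
      Ring.inverse (toCoordRing Ω (X 2)) := by simp [polyInvolution]
  rw [this, mul_left_comm, Ring.mul_inverse_cancel _ (isUnit_X_two Ω), mul_one]

lemma polyInvolution_X_three_sub_one :
    polyInvolution Ω (X 3 - 1) = toCoordRing Ω (X 3 - 1) := by
  simp [polyInvolution_X_three]

lemma polyInvolution_X_three_sub_sq :
    polyInvolution Ω (X 3 - X 0 ^ 2) = toCoordRing Ω (X 3 - X 0 ^ 2) := by
  simp [polyInvolution_X_three, polyInvolution_X_zero]

lemma polyInvolution_discriminant_mul :
    toCoordRing Ω (discriminant Ω) * polyInvolution Ω (discriminant Ω) =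
      toCoordRing Ω (X 3 ^ 3 * (X 3 - 1) ^ 3 * (X 3 - X 0 ^ 2) ^ 3) := by
  have h1 := polyInvolution_X_one_mul Ω
  have h2 := polyInvolution_X_two_mul Ω
  have hD : ∀ f : MvPolynomial (Fin 4) Ω →ₐ[Ω] CoordRing Ω, f (discriminant Ω) =
      f (X 1) * (f (X 2) * (f (X 3) * (f (X 3 - 1) * f (X 3 - X 0 ^ 2)))) := fun f => by
    simp only [← map_mul]
    rfl
  rw [hD, hD]
  simp only [map_mul, map_pow, polyInvolution_X_three, polyInvolution_X_three_sub_one,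
    polyInvolution_X_three_sub_sq] at h2 ⊢
  generalize toCoordRing Ω (X 3 - 1) = d at *
  generalize toCoordRing Ω (X 3 - X 0 ^ 2) = e at *
  generalize toCoordRing Ω (X 3) = z at *
  calc _ = (toCoordRing Ω (X 1) * polyInvolution Ω (X 1)) *
        (toCoordRing Ω (X 2) * polyInvolution Ω (X 2)) * z ^ 2 * d ^ 2 * e ^ 2 := by ring
    _ = _ := by rw [h1, h2]; ring

lemma isUnit_polyInvolution_discriminant : IsUnit (polyInvolution Ω (discriminant Ω)) := by
  refine isUnit_of_dvd_unit ⟨_, (polyInvolution_discriminant_mul Ω).symm.trans (mul_comm _ _)⟩ ?_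
  simp only [map_mul, map_pow]
  exact (((isUnit_X_three Ω).pow 3).mul ((isUnit_X_three_sub_one Ω).pow 3)).mul
    ((isUnit_X_three_sub_sq Ω).pow 3)

/-- The involution on the coordinate ring. -/
def coordInvolution : CoordRing Ω →+* CoordRing Ω :=
  IsLocalization.Away.lift (discriminant Ω)
    (g := (polyInvolution Ω : MvPolynomial (Fin 4) Ω →+* CoordRing Ω))
    (isUnit_polyInvolution_discriminant Ω)

lemma coordInvolution_toCoordRing (x : MvPolynomial (Fin 4) Ω) :
    coordInvolution Ω (toCoordRing Ω x) = polyInvolution Ω x :=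
  IsLocalization.Away.lift_eq _ _ _

lemma coordInvolution_involutive (x : CoordRing Ω) :
    coordInvolution Ω (coordInvolution Ω x) = x := by
  have key : (coordInvolution Ω).comp
      (polyInvolution Ω : MvPolynomial (Fin 4) Ω →+* CoordRing Ω) =
      (toCoordRing Ω : MvPolynomial (Fin 4) Ω →+* CoordRing Ω) := by
    refine MvPolynomial.ringHom_ext (fun c => ?_) (fun i => ?_)
    · have hc : ∀ f : MvPolynomial (Fin 4) Ω →ₐ[Ω] CoordRing Ω,
          f (MvPolynomial.C c) = algebraMap Ω _ c := fun f => f.commutes c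
      simp only [RingHom.comp_apply, RingHom.coe_coe]
      rw [hc (polyInvolution Ω), ← hc (toCoordRing Ω), coordInvolution_toCoordRing, hc, hc]
    · simp only [RingHom.comp_apply, RingHom.coe_coe]
      have cancel : ∀ {x y : MvPolynomial (Fin 4) Ω}, IsUnit (toCoordRing Ω x) →
          IsUnit (toCoordRing Ω y) → toCoordRing Ω x * polyInvolution Ω x = toCoordRing Ω y →
          polyInvolution Ω y = toCoordRing Ω y →
          coordInvolution Ω (polyInvolution Ω x) = toCoordRing Ω x := by
        intro x y hx hy h hy'
        have h' := congrArg (coordInvolution Ω) h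
        rw [map_mul, coordInvolution_toCoordRing, coordInvolution_toCoordRing, hy', ← h,
          mul_comm] at h'
        have hx' : IsUnit (polyInvolution Ω x) :=
          isUnit_of_dvd_unit ⟨_, h.symm.trans (mul_comm _ _)⟩ hy
        exact hx'.mul_left_injective h'
      fin_cases i
      · simp [polyInvolution_X_zero, coordInvolution_toCoordRing]
      · exact cancel (isUnit_X_one Ω) (isUnit_X_three Ω) (polyInvolution_X_one_mul Ω)
          (polyInvolution_X_three Ω)
      · refine cancel (isUnit_X_two Ω) ?_ (polyInvolution_X_two_mul Ω) ?_
        · rw [map_mul]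
          exact (isUnit_X_three_sub_one Ω).mul (isUnit_X_three_sub_sq Ω)
        · rw [map_mul, map_mul, polyInvolution_X_three_sub_one, polyInvolution_X_three_sub_sq]
      · simp [polyInvolution_X_three, coordInvolution_toCoordRing]
  have : (coordInvolution Ω).comp (coordInvolution Ω) = RingHom.id _ := by
    refine IsLocalization.ringHom_ext (Submonoid.powers (discriminant Ω)) ?_
    rw [RingHom.comp_assoc, RingHom.id_comp]
    refine Eq.trans (congrArg _ ?_) key
    exact RingHom.ext fun x => coordInvolution_toCoordRing Ω x
  exact DFunLike.congr_fun this x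

lemma not_dvd_of_eval {p q : MvPolynomial (Fin 4) Ω} (v : Fin 4 → Ω) (hp : eval v p = 0)
    (hq : eval v q ≠ 0) : ¬ p ∣ q := by
  rintro ⟨c, rfl⟩
  simp [hp] at hq

lemma isUnit_mul_coordInvolution_ne (h2 : (2 : Ω) ≠ 0) (hi : ∃ i : Ω, i ^ 2 = -1) (w : CoordRing Ω)
    (hw : IsUnit w) : w * coordInvolution Ω w ≠ toCoordRing Ω (X 3 - 1) := by
  intro h
  obtain ⟨v, hv⟩ := hw.exists_right_inv
  obtain ⟨n, P, hP⟩ := IsLocalization.Away.surj (discriminant Ω) w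
  obtain ⟨m, Q, hQ⟩ := IsLocalization.Away.surj (discriminant Ω) v
  change w * toCoordRing Ω _ ^ n = toCoordRing Ω P at hP
  change v * toCoordRing Ω _ ^ m = toCoordRing Ω Q at hQ
  have hdvd : P ∣ discriminant Ω ^ (n + m) := by
    refine ⟨Q, toCoordRing_injective Ω ?_⟩
    rw [map_mul, ← hP, ← hQ, map_pow, pow_add]
    linear_combination (- toCoordRing Ω (discriminant Ω) ^ n *
      toCoordRing Ω (discriminant Ω) ^ m) * hv
  simp only [discriminant, mul_pow] at hdvd
  obtain ⟨b₁, P₁, rfl, h_dvd1⟩ := exists_eq_pow_mul_of_dvd (MvPolynomial.X_prime) _ hdvd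
  obtain ⟨b₂, P₂, rfl, h_dvd2⟩ := exists_eq_pow_mul_of_dvd (MvPolynomial.X_prime) _ h_dvd1
  obtain ⟨b₃, P₃, rfl, h_dvd3⟩ := exists_eq_pow_mul_of_dvd (MvPolynomial.X_prime) _ h_dvd2
  obtain ⟨b₄, P₄, rfl, h_dvd4⟩ := exists_eq_pow_mul_of_dvd (prime_X_three_sub_one Ω) _ h_dvd3
  rw [← mul_one ((X 3 - X 0 ^ 2 : MvPolynomial (Fin 4) Ω) ^ (n + m))] at h_dvd4
  obtain ⟨b₅, P₅, rfl, h_dvd5⟩ := exists_eq_pow_mul_of_dvd (prime_X_three_sub_sq Ω) _ h_dvd4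
  obtain ⟨ω, hω, rfl⟩ := MvPolynomial.isUnit_iff_eq_C_of_isReduced.1 (isUnit_of_dvd_one h_dvd5)
  have hC : ∀ f : MvPolynomial (Fin 4) Ω →ₐ[Ω] CoordRing Ω,
    f (MvPolynomial.C ω) = algebraMap Ω _ ω := fun f => f.commutes ω
  have hP' := congrArg (coordInvolution Ω) hP
  rw [map_mul, map_pow, coordInvolution_toCoordRing, coordInvolution_toCoordRing] at hP'
  have hD := polyInvolution_discriminant_mul Ω
  have h1 := polyInvolution_X_one_mul Ω
  have h2' := polyInvolution_X_two_mul Ω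
  have main : (X 3 - 1 : MvPolynomial (Fin 4) Ω) *
      (X 3 ^ 3 * (X 3 - 1) ^ 3 * (X 3 - X 0 ^ 2) ^ 3) ^ n =
      MvPolynomial.C ω ^ 2 * X 3 ^ (b₁ + 2 * b₃) * (X 3 - 1) ^ (b₂ + 2 * b₄) *
        (X 3 - X 0 ^ 2) ^ (b₂ + 2 * b₅) := by
    apply toCoordRing_injective Ω
    rw [map_mul, map_pow _ _ n, ← hD, ← h]
    calc w * coordInvolution Ω w * (toCoordRing Ω (discriminant Ω) *
          polyInvolution Ω (discriminant Ω)) ^ n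
        = (w * toCoordRing Ω (discriminant Ω) ^ n) *
          (coordInvolution Ω w * polyInvolution Ω (discriminant Ω) ^ n) := by ring
      _ = _ := by
        rw [hP, hP']
        simp only [map_mul, map_pow, hC, polyInvolution_X_three,
          polyInvolution_X_three_sub_one, polyInvolution_X_three_sub_sq] at h2' ⊢
        generalize toCoordRing Ω (X 3 - 1) = d at *
        generalize toCoordRing Ω (X 3 - X 0 ^ 2) = e at *
        generalize toCoordRing Ω (X 3) = z at *
        calc _ = (toCoordRing Ω (X 1) * polyInvolution Ω (X 1)) ^ b₁ *
              (toCoordRing Ω (X 2) * polyInvolution Ω (X 2)) ^ b₂ * (z ^ b₃) ^ 2 * (d ^ b₄) ^ 2 *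
              (e ^ b₅) ^ 2 * (algebraMap Ω (CoordRing Ω) ω) ^ 2 := by ring
          _ = _ := by rw [h1, h2']; ring
  simp only [mul_pow, ← pow_mul] at main
  obtain ⟨i, hi⟩ := hi
  have hω0 := hω.ne_zero
  have e₁ := (AngularComponent.pow_mul_unique (prime_X_three_sub_one Ω) (m := 1 + 3 * n)
    (n := b₂ + 2 * b₄) (a := X 3 ^ (3 * n) * (X 3 - X 0 ^ 2) ^ (3 * n))
    (b := MvPolynomial.C ω ^ 2 * X 3 ^ (b₁ + 2 * b₃) * (X 3 - X 0 ^ 2) ^ (b₂ + 2 * b₅))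
    (not_dvd_of_eval Ω ![0, 0, 0, 1] (by simp) (by simp))
    (not_dvd_of_eval Ω ![0, 0, 0, 1] (by simp) (by simp [hω0])) (by
      linear_combination main)).1
  have hi2 : (-1 - 1 : Ω) ≠ 0 := by
    rw [← neg_add', neg_ne_zero, one_add_one_eq_two]
    exact h2
  have e₂ := (AngularComponent.pow_mul_unique (prime_X_three_sub_sq Ω) (m := 3 * n)
    (n := b₂ + 2 * b₅) (a := (X 3 - 1) * X 3 ^ (3 * n) * (X 3 - 1) ^ (3 * n))
    (b := MvPolynomial.C ω ^ 2 * X 3 ^ (b₁ + 2 * b₃) * (X 3 - 1) ^ (b₂ + 2 * b₄))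
    (not_dvd_of_eval Ω ![i, 0, 0, -1] (by simp [hi]) (by simp [hi2]))
    (not_dvd_of_eval Ω ![i, 0, 0, -1] (by simp [hi]) (by simp [hi2, hω0])) (by
      linear_combination main)).1
  omega

theorem exists_involution_norm_ne (h2 : (2 : Ω) ≠ 0) (hi : ∃ i : Ω, i ^ 2 = -1) :
    ∃ (τ : FractionRing (CoordRing Ω) →+* FractionRing (CoordRing Ω))
      (j : MvPolynomial (Fin 4) Ω →+* FractionRing (CoordRing Ω)), Function.Injective j ∧
      (∀ c, τ (j (MvPolynomial.C c)) = j (MvPolynomial.C c)) ∧ τ (j (X 0)) = -j (X 0) ∧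
      j (X 1) * τ (j (X 1)) = j (X 3) ∧
      j (X 2) * τ (j (X 2)) = (j (X 3) - 1) * (j (X 3) - j (X 0) ^ 2) ∧ τ (j (X 3)) = j (X 3) ∧
      ∀ h, h * τ h ≠ j (X 3) - 1 := by
  have hinj : Function.Injective (coordInvolution Ω) :=
    Function.LeftInverse.injective (coordInvolution_involutive Ω)
  let τ : FractionRing (CoordRing Ω) →+* FractionRing (CoordRing Ω) := IsFractionRing.map hinj
  have hι := IsFractionRing.injective (CoordRing Ω) (FractionRing (CoordRing Ω))
  have hτ : ∀ x, τ (algebraMap (CoordRing Ω) _ x) = algebraMap (CoordRing Ω) _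
      (coordInvolution Ω x) := fun x => IsLocalization.map_eq _ x
  let j : MvPolynomial (Fin 4) Ω →+* FractionRing (CoordRing Ω) :=
    (algebraMap (CoordRing Ω) _).comp (toCoordRing Ω : MvPolynomial (Fin 4) Ω →+* CoordRing Ω)
  have hj : ∀ x, j x = algebraMap (CoordRing Ω) _ (toCoordRing Ω x) := fun x => rfl
  have hτj : ∀ x, τ (j x) = algebraMap (CoordRing Ω) _ (polyInvolution Ω x) := fun x => by
    rw [hj, hτ, coordInvolution_toCoordRing]
  refine ⟨τ, j, hι.comp (toCoordRing_injective Ω), fun c => ?_, ?_, ?_, ?_, ?_, fun h hh => ?_⟩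
  · rw [hτj, hj]
    exact congrArg _ (((polyInvolution Ω).commutes c).trans ((toCoordRing Ω).commutes c).symm)
  · rw [hτj, hj, polyInvolution_X_zero, map_neg]
  · rw [hτj, hj, ← map_mul, polyInvolution_X_one_mul, hj]
  · rw [hτj, hj, ← map_mul, polyInvolution_X_two_mul, ← hj]
    simp
  · rw [hτj, hj, polyInvolution_X_three]
  · obtain ⟨P, Q, hQ, rfl⟩ := IsFractionRing.div_surjective (A := CoordRing Ω) h
    have hβ : j (X 3) - 1 = algebraMap (CoordRing Ω) _ (toCoordRing Ω (X 3 - 1)) := by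
      rw [← hj]
      simp
    have hβ0 := (isUnit_X_three_sub_one Ω).ne_zero
    have hQ0 : algebraMap (CoordRing Ω) (FractionRing (CoordRing Ω)) Q ≠ 0 :=
      (map_ne_zero_iff _ hι).2 (nonZeroDivisors.ne_zero hQ)
    rw [hβ, map_div₀, div_mul_div_comm, div_eq_iff (mul_ne_zero hQ0 ((map_ne_zero τ).2 hQ0)),
      hτ, hτ] at hh
    simp only [← map_mul] at hh
    have hP0 : P ≠ 0 := by
      rintro rfl
      have := hι hh
      rw [zero_mul, eq_comm, mul_eq_zero, mul_eq_zero, map_eq_zero_iff _ hinj, or_self] at this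
      exact this.elim hβ0 (nonZeroDivisors.ne_zero hQ)
    obtain ⟨w, hw, hw'⟩ := exists_isUnit_mul_map_eq (coordInvolution Ω)
      (coordInvolution_involutive Ω) (isUnit_X_three_sub_one Ω) P hP0 Q
      (nonZeroDivisors.ne_zero hQ) (hι hh)
    exact isUnit_mul_coordInvolution_ne Ω h2 hi w hw hw'

end Involution

section FixedField

universe u

variable {k L F : Type u} [Field k] [Field L] [Field F] [Algebra k L]

lemma mem_fixedField_zpowers_iff {ρ : L ≃ₐ[k] L} {y : L} :
    y ∈ IntermediateField.fixedField (Subgroup.zpowers ρ) ↔ ρ y = y := by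
  rw [IntermediateField.mem_fixedField_iff]
  refine ⟨fun h => h ρ (Subgroup.mem_zpowers ρ), fun h f hf => ?_⟩
  have hle : Subgroup.zpowers ρ ≤ MulAction.stabilizer (L ≃ₐ[k] L) y :=
    Subgroup.zpowers_le.2 (MulAction.mem_stabilizer_iff.2 h)
  exact MulAction.mem_stabilizer_iff.1 (hle hf)

/-- If the class `(x₁², x₄ - 1)` is nontrivial at a point of the fixed field and trivial at another
one, then the fixed field is not retract rational. -/
theorem not_isRetractRational_fixedField (h2 : (2 : L) ≠ 0) (ρ : L ≃ₐ[k] L) {x₁ x₂ x₃ x₄ : L}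
    (n₁ : x₁ ≠ 0) (n₂ : x₂ ≠ 0) (n₃ : x₃ ≠ 0) (n₄ : x₄ ≠ 0) (n₅ : x₄ - 1 ≠ 0)
    (n₆ : x₄ - x₁ ^ 2 ≠ 0) (r₁ : ρ x₁ = -x₁) (r₂ : ρ x₂ = x₄ * x₂⁻¹)
    (r₃ : ρ x₃ = (x₄ - 1) * (x₄ - x₁ ^ 2) * x₃⁻¹) (r₄ : ρ x₄ = x₄)
    (τ : F →+* F) (hi : ∃ i, τ i = i ∧ i ^ 2 = -1) (g₀ g₁ : L →+* F)
    (hg₀ : ∀ y, τ (g₀ y) = g₀ (ρ y)) (hg₁ : ∀ y, τ (g₁ y) = g₁ y)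
    (hg : g₀.comp (algebraMap k L) = g₁.comp (algebraMap k L))
    (hne : ∀ h, h * τ h ≠ g₀ x₄ - 1) :
    ¬ IsRetractRational k (IntermediateField.fixedField (Subgroup.zpowers ρ)) := by
  intro hret
  let K := IntermediateField.fixedField (Subgroup.zpowers ρ)
  let M : Subfield F := τ.eqLocusField (RingHom.id F)
  have hM : ∀ {y}, y ∈ M ↔ τ y = y := Iff.rfl
  let γ₀ : K →+* M := (g₀.comp (algebraMap K L)).codRestrict M fun y =>
    hM.2 ((hg₀ y).trans (congrArg g₀ (mem_fixedField_zpowers_iff.1 y.2)))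
  let γ₁ : K →+* M := (g₁.comp (algebraMap K L)).codRestrict M fun y => hM.2 (hg₁ y)
  have hK : ∀ {y : L}, ρ y = y → y ∈ K := mem_fixedField_zpowers_iff.2
  have h2M : (2 : M) ≠ 0 := by
    intro h
    have : g₀ 2 = 0 := by rw [map_ofNat]; exact congrArg Subtype.val h
    exact h2 ((map_eq_zero g₀).1 this)
  obtain ⟨i, hτi, hi⟩ := hi
  let a : K := ⟨x₁ ^ 2, hK (by simp [r₁])⟩
  let z : K := ⟨x₄, hK r₄⟩
  let u : K := ⟨(x₂ + x₄ * x₂⁻¹) / 2, hK (by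
    simp only [map_div₀, map_add, map_mul, map_inv₀, map_ofNat, r₂, r₄]
    field_simp
    ring)⟩
  let v : K := ⟨(x₂ - x₄ * x₂⁻¹) / (2 * x₁), hK (by
    simp only [map_div₀, map_sub, map_mul, map_inv₀, map_ofNat, r₁, r₂, r₄]
    field_simp
    ring)⟩
  let r : K := ⟨(x₃ + (x₄ - 1) * (x₄ - x₁ ^ 2) * x₃⁻¹) / 2, hK (by
    simp only [map_div₀, map_add, map_sub, map_one, map_pow, map_mul, map_inv₀, map_ofNat, r₁, r₃,
      r₄, neg_sq]
    field_simp
    ring)⟩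
  let s : K := ⟨(x₃ - (x₄ - 1) * (x₄ - x₁ ^ 2) * x₃⁻¹) / (2 * x₁), hK (by
    simp only [map_div₀, map_sub, map_one, map_pow, map_mul, map_inv₀, map_ofNat, r₁, r₃, r₄,
      neg_sq]
    field_simp
    ring)⟩
  have ne : ∀ {y : K}, (y : L) ≠ 0 → y ≠ 0 := fun h h' => h (congrArg Subtype.val h')
  have hnorm : IsNormForm (γ₀ a) (γ₀ z - 1) := by
    refine hret.isNormForm (u := u) (v := v) (r := r) (s := s) (w := ⟨g₁ x₁, hM.2 (hg₁ x₁)⟩) h2M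
      ⟨⟨i, hM.2 hτi⟩, Subtype.ext hi⟩ γ₀ γ₁ ?_ (ne (pow_ne_zero 2 n₁)) (ne n₄) (ne n₅) (ne n₆)
      (Subtype.ext ?_) (Subtype.ext ?_) (Subtype.ext (map_pow g₁ x₁ 2))
    · exact RingHom.ext fun c => Subtype.ext (DFunLike.congr_fun hg c)
    · change x₄ = ((x₂ + x₄ * x₂⁻¹) / 2) ^ 2 - x₁ ^ 2 * ((x₂ - x₄ * x₂⁻¹) / (2 * x₁)) ^ 2
      field_simp
      ring
    · change (x₄ - 1) * (x₄ - x₁ ^ 2) = ((x₃ + (x₄ - 1) * (x₄ - x₁ ^ 2) * x₃⁻¹) / 2) ^ 2 -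
        x₁ ^ 2 * ((x₃ - (x₄ - 1) * (x₄ - x₁ ^ 2) * x₃⁻¹) / (2 * x₁)) ^ 2
      field_simp
      ring
  obtain ⟨⟨p, hp⟩, ⟨q, hq⟩, hpq⟩ := hnorm
  refine hne (p + g₀ x₁ * q) ?_
  have h : g₀ x₄ - 1 = p ^ 2 - g₀ (x₁ ^ 2) * q ^ 2 := congrArg Subtype.val hpq
  rw [map_add, map_mul, hM.1 hp, hM.1 hq, hg₀, r₁, map_neg, h, map_pow]
  ring

end FixedField

/-- **Hoshi–Kang–Kitayama.** Let `k` be a field with `char k ≠ 2` and let `ρ` be the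
`k`-automorphism of `k(x₁,x₂,x₃,x₄)` of order 2 given by `ρ(x₁) = -x₁`, `ρ(x₂) = x₄/x₂`,
`ρ(x₃) = (x₄-1)(x₄-x₁²)/x₃`, `ρ(x₄) = x₄`.
Then `k(x₁,x₂,x₃,x₄)^⟨ρ⟩` is not retract `k`-rational. -/
theorem C2_four_variables_not_retract_rational
    (k : Type*) [Field k] (hchar : ringChar k ≠ 2)
    (ρ : FractionRing (MvPolynomial (Fin 4) k) ≃ₐ[k] FractionRing (MvPolynomial (Fin 4) k))
    (hρ1 : ρ (algebraMap (MvPolynomial (Fin 4) k) _ (X 0)) =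
      - algebraMap (MvPolynomial (Fin 4) k) _ (X 0))
    (hρ2 : ρ (algebraMap (MvPolynomial (Fin 4) k) _ (X 1)) =
      algebraMap (MvPolynomial (Fin 4) k) _ (X 3) *
        (algebraMap (MvPolynomial (Fin 4) k) _ (X 1))⁻¹)
    (hρ3 : ρ (algebraMap (MvPolynomial (Fin 4) k) _ (X 2)) =
      (algebraMap (MvPolynomial (Fin 4) k) _ (X 3) - 1) *
        (algebraMap (MvPolynomial (Fin 4) k) _ (X 3) -
          (algebraMap (MvPolynomial (Fin 4) k) _ (X 0)) ^ 2) *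
        (algebraMap (MvPolynomial (Fin 4) k) _ (X 2))⁻¹)
    (hρ4 : ρ (algebraMap (MvPolynomial (Fin 4) k) _ (X 3)) =
      algebraMap (MvPolynomial (Fin 4) k) _ (X 3)) :
    ¬ IsRetractRational k (IntermediateField.fixedField (Subgroup.zpowers ρ)) := by
  let L := FractionRing (MvPolynomial (Fin 4) k)
  let Ω := AlgebraicClosure L
  let x : MvPolynomial (Fin 4) k →+* L := algebraMap _ _
  have hx : Function.Injective x := IsFractionRing.injective _ _
  have h2L : (2 : L) ≠ 0 := by
    have := (map_ne_zero (algebraMap k L)).2 (Ring.two_ne_zero hchar)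
    rwa [map_ofNat] at this
  have h2 : (2 : Ω) ≠ 0 := by
    have := (map_ne_zero (algebraMap L Ω)).2 h2L
    rwa [map_ofNat] at this
  have hi : ∃ i : Ω, i ^ 2 = -1 := IsAlgClosed.exists_pow_nat_eq (-1) two_pos
  obtain ⟨τ, j, hj, hC, h0, h1, h2', h3, hne⟩ := exists_involution_norm_ne Ω h2 hi
  let F := FractionRing (CoordRing Ω)
  let θ : k →+* Ω := (algebraMap L Ω).comp (algebraMap k L)
  let g₀ : L →+* F := IsFractionRing.lift (g := j.comp (MvPolynomial.map θ))
    (hj.comp (MvPolynomial.map_injective _ θ.injective))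
  let g₁ : L →+* F := (j.comp MvPolynomial.C).comp (algebraMap L Ω)
  have hg₀ : ∀ p, g₀ (x p) = j (MvPolynomial.map θ p) := fun p => IsFractionRing.lift_algebraMap _ p
  have hg₀X : ∀ i, g₀ (x (X i)) = j (X i) := fun i => by rw [hg₀, MvPolynomial.map_X]
  have hg₀C : ∀ c, g₀ (algebraMap k L c) = j (MvPolynomial.C (θ c)) := fun c => by
    rw [IsScalarTower.algebraMap_apply k (MvPolynomial (Fin 4) k) L, MvPolynomial.algebraMap_eq]
    exact (hg₀ _).trans (by rw [MvPolynomial.map_C])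
  have hjX : ∀ i, j (X i) ≠ 0 := fun i => (map_ne_zero_iff j hj).2 (X_ne_zero i)
  replace hρ1 : ρ (x (X 0)) = -x (X 0) := hρ1
  replace hρ2 : ρ (x (X 1)) = x (X 3) * (x (X 1))⁻¹ := hρ2
  replace hρ3 : ρ (x (X 2)) = (x (X 3) - 1) * (x (X 3) - x (X 0) ^ 2) * (x (X 2))⁻¹ := hρ3
  replace hρ4 : ρ (x (X 3)) = x (X 3) := hρ4
  have hτρ : ∀ y, τ (g₀ y) = g₀ (ρ y) := by
    have : τ.comp g₀ = g₀.comp (ρ : L →+* L) := by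
      refine IsLocalization.ringHom_ext (nonZeroDivisors (MvPolynomial (Fin 4) k)) ?_
      refine MvPolynomial.ringHom_ext (fun c => ?_) (fun i => ?_)
      · change τ (g₀ (algebraMap _ L (MvPolynomial.C c))) =
          g₀ (ρ (algebraMap _ L (MvPolynomial.C c)))
        rw [← MvPolynomial.algebraMap_eq, ← IsScalarTower.algebraMap_apply k _ L, ρ.commutes,
          hg₀C, hC]
      · change τ (g₀ (x (X i))) = g₀ (ρ (x (X i)))
        fin_cases i
        · change τ (g₀ (x (X 0))) = g₀ (ρ (x (X 0)))
          rw [hρ1, map_neg, hg₀X, h0]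
        · change τ (g₀ (x (X 1))) = g₀ (ρ (x (X 1)))
          rw [hρ2, map_mul, map_inv₀, hg₀X, hg₀X, eq_mul_inv_iff_mul_eq₀ (hjX 1), mul_comm, h1]
        · change τ (g₀ (x (X 2))) = g₀ (ρ (x (X 2)))
          rw [hρ3, map_mul, map_inv₀, map_mul, map_sub, map_sub, map_one, map_pow, hg₀X, hg₀X,
            hg₀X, eq_mul_inv_iff_mul_eq₀ (hjX 2), mul_comm, h2']
        · change τ (g₀ (x (X 3))) = g₀ (ρ (x (X 3)))
          rw [hρ4, hg₀X, h3]
    exact DFunLike.congr_fun this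
  have nX : ∀ i, x (X i) ≠ 0 := fun i => (map_ne_zero_iff x hx).2 (X_ne_zero i)
  have n₅ : x (X 3) - 1 ≠ 0 := by
    rw [← map_one x, ← map_sub]
    exact (map_ne_zero_iff x hx).2 (prime_X_three_sub_one k).ne_zero
  have n₆ : x (X 3) - x (X 0) ^ 2 ≠ 0 := by
    rw [← map_pow, ← map_sub]
    exact (map_ne_zero_iff x hx).2 (prime_X_three_sub_sq k).ne_zero
  obtain ⟨i, hi⟩ := hi
  refine not_isRetractRational_fixedField h2L ρ (nX 0) (nX 1) (nX 2) (nX 3) n₅ n₆ hρ1 hρ2 hρ3 hρ4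
    τ ⟨j (MvPolynomial.C i), hC i, ?_⟩ g₀ g₁ hτρ (fun y => hC _) (RingHom.ext hg₀C) ?_
  · rw [← map_pow, ← map_pow, hi, map_neg, map_neg, map_one, map_one]
  · rw [hg₀X]
    exact hne
end
end

section
/- Let K/k be a finite Galois extension of fields with group G = Gal(K/k), and let G act on the rational function field K(x1,x2) extending its action on K, such that for each σ ∈ G, σ(x_j) = x1^{a_{1j}(σ)}·x2^{a_{2j}(σ)} (j = 1,2) where the matrix [a_{ij}(σ)] ∈ GL_2(ℤ) (a purely quasi-monomial action). Then the fixed field K(x1,x2)^G is k-rational. (Equivalently: every two-dimensional algebraic k-torus is k-rational.) -/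
open MvPolynomial

noncomputable section

/-- A field extension `K` of `k` is `k`-rational if it is isomorphic, as a `k`-algebra,
to a rational function field `k(x₁, …, xₙ)` in finitely many variables. -/
def IsRational (k K : Type*) [Field k] [Field K] [Algebra k K] : Prop :=
  ∃ n : ℕ, Nonempty (K ≃ₐ[k] FractionRing (MvPolynomial (Fin n) k))

section Descent

variable {k K L : Type*} [Field k] [Field K] [Field L] [Algebra k K] [Algebra K L] [Algebra k L]
  [IsScalarTower k K L]

lemma algebraicIndependent_of_adjoin_eq_top {x t : Fin 2 → L} (hx : AlgebraicIndependent K x)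
    (ht : IntermediateField.adjoin K (Set.range t) = ⊤) : AlgebraicIndependent K t := by
  have : Algebra.IsAlgebraic (Algebra.adjoin K (Set.range t)) L := by
    constructor
    intro z
    have hz : z ∈ IntermediateField.adjoin K (Set.range t) := ht ▸ trivial
    obtain ⟨r, hr, s, hs, rfl⟩ := IntermediateField.mem_adjoin_iff_div.1 hz
    rw [div_eq_mul_inv]
    exact (isAlgebraic_algebraMap (A := L) (⟨r, hr⟩ : Algebra.adjoin K (Set.range t))).mul
      (isAlgebraic_algebraMap (A := L) (⟨s, hs⟩ : Algebra.adjoin K (Set.range t))).inv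
  refine (Algebra.IsAlgebraic.isTranscendenceBasis_of_lift_le_trdeg_of_finite K t ?_).1
  exact hx.lift_cardinalMk_le_trdeg

lemma fixedField_eq_adjoin [IsGalois k K] [FiniteDimensional k K]
    (ρ : (K ≃ₐ[k] K) →* (L ≃ₐ[k] L))
    (hext : ∀ σ c, ρ σ (algebraMap K L c) = algebraMap K L (σ c)) {S : Set L}
    (hS : IntermediateField.adjoin K S = ⊤) (hfix : ∀ σ, ∀ s ∈ S, ρ σ s = s) :
    IntermediateField.fixedField ρ.range = IntermediateField.adjoin k S := by
  apply le_antisymm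
  · intro z hz
    set F := IntermediateField.adjoin k S with hF
    set E := (IsScalarTower.toAlgHom k K L).fieldRange with hE
    let e : K ≃ₐ[k] E := AlgEquiv.ofInjectiveField (IsScalarTower.toAlgHom k K L)
    have hEgal : IsGalois k E := IsGalois.of_algEquiv e
    have hEfin : FiniteDimensional k E := e.toLinearEquiv.finiteDimensional
    have hsup : E ⊔ F = ⊤ := by
      let M : IntermediateField K L :=
        { (E ⊔ F).toSubfield with
          algebraMap_mem' := fun c => (le_sup_left : E ≤ E ⊔ F) ⟨c, rfl⟩ }
      have hM : M = ⊤ := by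
        rw [eq_top_iff, ← hS, IntermediateField.adjoin_le_iff]
        intro s hs
        exact (le_sup_right : F ≤ E ⊔ F) (IntermediateField.subset_adjoin k S hs)
      rw [eq_top_iff]
      intro w _
      have : w ∈ M := hM ▸ trivial
      exact this
    have := IsGalois.sup_right E F hsup
    have hz' : z ∈ (⊥ : IntermediateField F L) := by
      rw [InfiniteGalois.mem_bot_iff_fixed]
      intro τ
      let σ : K ≃ₐ[k] K := (τ.restrictScalars k).restrictNormal K
      have hτ : τ.restrictScalars k = ρ σ := by
        have hτK (c : K) : τ (algebraMap K L c) = algebraMap K L (σ c) :=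
          ((τ.restrictScalars k).restrictNormal_commutes K c).symm
        let N : IntermediateField k L :=
          { carrier := {w | τ w = ρ σ w}
            mul_mem' := fun {a b} ha hb => by simp_all
            add_mem' := fun {a b} ha hb => by simp_all
            inv_mem' := fun a ha => by simp_all
            algebraMap_mem' := fun c =>
              ((τ.restrictScalars k).commutes c).trans ((ρ σ).commutes c).symm }
        have hN : E ⊔ F ≤ N := by
          refine sup_le ?_ ?_
          · rintro _ ⟨c, rfl⟩
            exact (hτK c).trans (hext σ c).symm
          · rw [hF, IntermediateField.adjoin_le_iff]
            intro s hs
            exact (τ.commutes ⟨s, IntermediateField.subset_adjoin k S hs⟩).trans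
              (hfix σ s hs).symm
        ext w
        exact hN (hsup ▸ trivial : w ∈ E ⊔ F)
      calc τ z = ρ σ z := DFunLike.congr_fun hτ z
        _ = z := hz ⟨ρ σ, σ, rfl⟩
    obtain ⟨y, rfl⟩ := hz'
    exact y.2
  · rw [IntermediateField.adjoin_le_iff]
    rintro s hs ⟨_, σ, rfl⟩
    exact hfix σ s hs

lemma isRational_fixedField [IsGalois k K] [FiniteDimensional k K]
    (ρ : (K ≃ₐ[k] K) →* (L ≃ₐ[k] L))
    (hext : ∀ σ c, ρ σ (algebraMap K L c) = algebraMap K L (σ c)) {x u : Fin 2 → L}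
    (hx : AlgebraicIndependent K x)
    (hu : IntermediateField.adjoin K (Set.range u) = ⊤) (hfix : ∀ σ i, ρ σ (u i) = u i) :
    IsRational k (IntermediateField.fixedField ρ.range) := by
  have hind : AlgebraicIndependent k u :=
    (algebraicIndependent_of_adjoin_eq_top hx hu).restrictScalars
      (FaithfulSMul.algebraMap_injective k K)
  refine ⟨2, ⟨(IntermediateField.equivOfEq (fixedField_eq_adjoin ρ hext hu ?_)).trans
    hind.aevalEquivField.symm⟩⟩
  rintro σ _ ⟨i, rfl⟩
  exact hfix σ i

end Descent

section Averaging

variable {k K : Type*} [Field k] [Field K] [Algebra k K] [FiniteDimensional k K]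

lemma exists_fixed_ne_zero {V : Type*} [AddCommGroup V] [Module K V]
    (S : (K ≃ₐ[k] K) → V →+ V) (h1 : ∀ v, S 1 v = v) (hmul : ∀ g h v, S (g * h) v = S g (S h v))
    (hS : ∀ g (c : K) v, S g (c • v) = g c • S g v)
    (φ : V →ₗ[K] K) {v : V} (hv : φ v ≠ 0) : ∃ w, (∀ g, S g w = w) ∧ φ w ≠ 0 := by
  by_contra! H
  have hli : LinearIndependent K (fun g : K ≃ₐ[k] K => ((g : K →* K) : K → K)) :=
    (linearIndependent_monoidHom K K).comp (fun g : K ≃ₐ[k] K => (g : K →* K))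
      (fun g h hgh => AlgEquiv.ext fun c => DFunLike.congr_fun hgh c)
  rw [Fintype.linearIndependent_iff] at hli
  apply hv
  have := hli (fun g => φ (S g v)) ?_ 1
  · simpa [h1] using this
  ext c
  have := H (∑ g, S g (c • v)) ?_
  · simpa [hS, mul_comm] using this
  intro h
  rw [map_sum]
  simp_rw [← hmul]
  exact Fintype.sum_equiv (Equiv.mulLeft h) _ _ (fun _ => rfl)

lemma exists_equivariant_ne {X : Type*} [MulAction (K ≃ₐ[k] K) X] {s t : X} (hst : s ≠ t) :
    ∃ f : X → K, (∀ (g : K ≃ₐ[k] K) x, f (g • x) = g (f x)) ∧ f s ≠ f t := by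
  classical
  let S (g : K ≃ₐ[k] K) : (X → K) →+ (X → K) :=
    { toFun := fun f x => g (f (g⁻¹ • x))
      map_zero' := by ext; simp
      map_add' := by intros; ext; simp }
  have hS (g : K ≃ₐ[k] K) (f : X → K) (x : X) : S g f x = g (f (g⁻¹ • x)) := rfl
  obtain ⟨f, hf, hne⟩ := exists_fixed_ne_zero S (by intros; ext; simp [hS])
    (by intros; ext; simp [hS, mul_smul]) (by intros; ext; simp [hS])
    (LinearMap.proj (R := K) (φ := fun _ : X => K) s - LinearMap.proj t)
    (v := Pi.single s 1) (by simp [hst.symm])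
  refine ⟨f, fun g x => ?_, fun h => hne (by simp [h])⟩
  conv_lhs => rw [← hf g]
  simp [hS]

end Averaging

section Lattice

open Matrix

lemma signed_permutation_of_form {a h c p r s t : ℤ} (ha : 0 < a) (hc : 0 < c)
    (h0 : 0 ≤ h) (hha : 2 * h < a) (hhc : 2 * h < c)
    (h1 : a * p ^ 2 + 2 * h * (p * r) + c * r ^ 2 = a)
    (h2 : a * s ^ 2 + 2 * h * (s * t) + c * t ^ 2 = c)
    (hdet : IsUnit (p * t - r * s)) :
    (r = 0 ∧ s = 0 ∧ IsUnit p ∧ IsUnit t) ∨ (p = 0 ∧ t = 0 ∧ IsUnit r ∧ IsUnit s) := by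
  wlog hac : a ≤ c generalizing a c p r s t
  · have := this (p := t) (r := s) (s := r) (t := p) hc ha hhc hha (by linarith) (by linarith)
      (by convert hdet using 1; ring) (by linarith)
    tauto
  have key {x y : ℤ} (hy : IsUnit y) (hxy : x * (a * x + 2 * h * y) = 0) : x = 0 := by
    by_contra hx
    have h3 : a * x + 2 * h * y = 0 := (mul_eq_zero.1 hxy).resolve_left hx
    rcases lt_or_gt_of_ne hx with hx | hx <;> rcases Int.isUnit_iff.1 hy with rfl | rfl <;>
      nlinarith
  have hpr : p * r = 0 := by
    by_contra hne
    have h3 : 1 ≤ |p * r| := Int.one_le_abs hne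
    have h4 : 2 * |p * r| ≤ p ^ 2 + r ^ 2 := by
      rw [abs_mul, ← sq_abs p, ← sq_abs r]
      nlinarith [sq_nonneg (|p| - |r|)]
    have h5 : -|p * r| ≤ p * r := neg_abs_le _
    have h6 : h * -|p * r| ≤ h * (p * r) := mul_le_mul_of_nonneg_left h5 h0
    have h7 : 0 ≤ (c - a) * r ^ 2 := mul_nonneg (by linarith) (sq_nonneg r)
    have h8 : a * (2 * |p * r|) ≤ a * (p ^ 2 + r ^ 2) := mul_le_mul_of_nonneg_left h4 ha.le
    have h9 : (a - 2 * h) * 1 ≤ (a - 2 * h) * |p * r| :=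
      mul_le_mul_of_nonneg_left h3 (by linarith)
    have h10 : a * 1 ≤ a * |p * r| := mul_le_mul_of_nonneg_left h3 ha.le
    linarith
  rcases mul_eq_zero.1 hpr with rfl | rfl
  · right
    have hrs : IsUnit r ∧ IsUnit s := by
      rw [← IsUnit.mul_iff]
      simpa using hdet
    have hr : r ^ 2 = 1 := by rcases Int.isUnit_iff.1 hrs.1 with rfl | rfl <;> rfl
    have hs : s ^ 2 = 1 := by rcases Int.isUnit_iff.1 hrs.2 with rfl | rfl <;> rfl
    have hca : c = a := by rw [hr] at h1; linarith
    refine ⟨rfl, key hrs.2 ?_, hrs⟩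
    rw [hs, hca] at h2
    linarith
  · left
    have hpt : IsUnit p ∧ IsUnit t := by
      rw [← IsUnit.mul_iff]
      simpa using hdet
    have ht : t ^ 2 = 1 := by rcases Int.isUnit_iff.1 hpt.2 with rfl | rfl <;> rfl
    refine ⟨rfl, key hpt.2 ?_, hpt⟩
    rw [ht] at h2
    linarith

lemma hexagonal_of_form {a h c p r s t : ℤ} (ha : 0 < a) (hc : 0 < c)
    (hha : 2 * h ≤ a) (hhc : 2 * h ≤ c) (hac : 2 * h = a ∨ 2 * h = c)
    (h1 : a * p ^ 2 + 2 * h * (p * r) + c * r ^ 2 = a)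
    (h2 : a * s ^ 2 + 2 * h * (s * t) + c * t ^ 2 = c)
    (h3 : a * (p * s) + h * (p * t + r * s) + c * (r * t) = h)
    (hdet : IsUnit (p * t - r * s)) :
    p ^ 2 + p * r + r ^ 2 = 1 ∧ s ^ 2 + s * t + t ^ 2 = 1 ∧
      2 * (p * s) + (p * t + r * s) + 2 * (r * t) = 1 := by
  wlog hah : 2 * h = a generalizing a c p r s t
  · obtain ⟨e1, e2, e3⟩ := this (p := t) (r := s) (s := r) (t := p) hc ha hhc hha hac.symm
      (by linarith) (by linarith) (by linarith) (by convert hdet using 1; ring)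
      (hac.resolve_left hah)
    exact ⟨by linarith, by linarith, by linarith⟩
  rw [hah] at h1 h2 hhc
  have hN {x y : ℤ} (hxy : x ≠ 0 ∨ y ≠ 0) : 1 ≤ x ^ 2 + x * y + y ^ 2 := by
    have : 0 < (2 * x + y) ^ 2 + 3 * y ^ 2 := by
      rcases eq_or_ne y 0 with rfl | hy
      · have : x ≠ 0 := by simpa using hxy
        have := pow_pos (abs_pos.2 this) 2
        rw [sq_abs] at this
        linarith
      · positivity
    by_contra hcon
    nlinarith
  have hpr : p ≠ 0 ∨ r ≠ 0 := by
    by_contra! hcon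
    simp [hcon.1, hcon.2] at hdet
  have hst : s ≠ 0 ∨ t ≠ 0 := by
    by_contra! hcon
    simp [hcon.1, hcon.2] at hdet
  have N1 := hN hpr
  have N2 := hN hst
  have h4 : 0 ≤ (c - a) * r ^ 2 := mul_nonneg (by linarith) (sq_nonneg r)
  have e1 : p ^ 2 + p * r + r ^ 2 = 1 := by nlinarith
  have h5 : (c - a) * r ^ 2 = 0 := by linear_combination h1 - a * e1
  have h6 : (c - a) * r = 0 := by
    rcases mul_eq_zero.1 h5 with h | h
    · simp [h]
    · simp [pow_eq_zero_iff two_ne_zero |>.1 h]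
  refine ⟨e1, ?_, ?_⟩
  · rcases eq_or_ne t 0 with rfl | ht
    · have : IsUnit s := isUnit_of_mul_isUnit_right (x := r) (by simpa using hdet)
      rcases Int.isUnit_iff.1 this with rfl | rfl <;> rfl
    · have h7 : 1 ≤ t ^ 2 := by
        have := pow_pos (abs_pos.2 ht) 2
        rw [sq_abs] at this
        linarith
      have h8 : 0 ≤ (c - a) * (t ^ 2 - 1) := mul_nonneg (by linarith) (by linarith)
      nlinarith
  · have : a * (2 * (p * s) + (p * t + r * s) + 2 * (r * t) - 1) = 0 := by
      linear_combination 2 * h3 - 2 * t * h6 - (p * t + r * s - 1) * hah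
    have := (mul_eq_zero.1 this).resolve_left ha.ne'
    linarith

lemma exists_reduced_gram {G : Type*} [Group G] [Fintype G]
    (A : G →* Matrix (Fin 2) (Fin 2) ℤ) : ∃ P Q : Matrix (Fin 2) (Fin 2) ℤ,
      P * Q = 1 ∧ Q * P = 1 ∧ ∃ a h c : ℤ, 0 < a ∧ 0 < c ∧ 0 ≤ h ∧ 2 * h ≤ a ∧ 2 * h ≤ c ∧
        ∀ g, (Q * A g * P)ᵀ * !![a, h; h, c] * (Q * A g * P) = !![a, h; h, c] := by
  classical
  let S (P : Matrix (Fin 2) (Fin 2) ℤ) : Matrix (Fin 2) (Fin 2) ℤ :=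
    ∑ g, (A g * P)ᵀ * (A g * P)
  have hS (P R) : S (P * R) = Rᵀ * S P * R := by
    simp only [S, Finset.mul_sum, Finset.sum_mul, transpose_mul, Matrix.mul_assoc]
  have hSinv (g P) : S (A g * P) = S P := by
    simp only [S, ← Matrix.mul_assoc _ (A g) P, ← map_mul]
    exact Fintype.sum_equiv (Equiv.mulRight g) _ _ (fun _ => rfl)
  have hsymm (P) : S P 1 0 = S P 0 1 := by
    have : (S P)ᵀ = S P := by
      simp [S, transpose_sum, transpose_mul]
    exact congrFun (congrFun this 0) 1
  have hpos (P : Matrix (Fin 2) (Fin 2) ℤ) (hP : IsUnit P) (j : Fin 2) : 0 < S P j j := by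
    have h1 : S P j j = ∑ g, ((A g * P) 0 j ^ 2 + (A g * P) 1 j ^ 2) := by
      simp only [S, Matrix.sum_apply]
      refine Finset.sum_congr rfl fun g _ => ?_
      rw [Matrix.mul_apply, Fin.sum_univ_two, Matrix.transpose_apply, Matrix.transpose_apply]
      ring
    have h2 : (A 1 * P) 0 j ^ 2 + (A 1 * P) 1 j ^ 2 ≤ S P j j := by
      rw [h1]
      exact Finset.single_le_sum (f := fun g => (A g * P) 0 j ^ 2 + (A g * P) 1 j ^ 2)
        (fun g _ => by positivity) (Finset.mem_univ 1)
    refine lt_of_lt_of_le ?_ h2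
    rw [map_one, one_mul]
    by_contra hcon
    have h3 : P 0 j = 0 := by nlinarith [sq_nonneg (P 0 j), sq_nonneg (P 1 j)]
    have h4 : P 1 j = 0 := by nlinarith [sq_nonneg (P 0 j), sq_nonneg (P 1 j)]
    have h5 := (Matrix.isUnit_iff_isUnit_det P).1 hP
    have h6 : P.det = 0 := Matrix.det_eq_zero_of_column_eq_zero j
      (fun i => by fin_cases i <;> assumption)
    simp [h6] at h5
  obtain ⟨P, hmin⟩ : ∃ P : (Matrix (Fin 2) (Fin 2) ℤ)ˣ, ∀ R : (Matrix (Fin 2) (Fin 2) ℤ)ˣ,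
      (S P 0 0 + S P 1 1).toNat ≤ (S R 0 0 + S R 1 1).toNat :=
    ⟨_, fun R => Function.argmin_le
      (fun P : (Matrix (Fin 2) (Fin 2) ℤ)ˣ => (S P 0 0 + S P 1 1).toNat) R⟩
  have hmin' (R : (Matrix (Fin 2) (Fin 2) ℤ)ˣ) :
      S P 0 0 + S P 1 1 ≤ ((R : Matrix (Fin 2) (Fin 2) ℤ)ᵀ * S P * R) 0 0 +
        ((R : Matrix (Fin 2) (Fin 2) ℤ)ᵀ * S P * R) 1 1 := by
    have h1 := hmin (P * R)
    have h2 := hpos (P * R : (Matrix (Fin 2) (Fin 2) ℤ)ˣ) (Units.isUnit _) 0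
    have h3 := hpos (P * R : (Matrix (Fin 2) (Fin 2) ℤ)ˣ) (Units.isUnit _) 1
    rw [← hS, ← Units.val_mul]
    omega
  have key (x y z w : ℤ) (hd : x * w - y * z = 1) := hmin'
    ⟨!![x, y; z, w], !![w, -y; -z, x], by
      ext i j; fin_cases i <;> fin_cases j <;> simp [Matrix.mul_apply, Fin.sum_univ_two] <;>
      linarith, by
      ext i j; fin_cases i <;> fin_cases j <;> simp [Matrix.mul_apply, Fin.sum_univ_two] <;>
      linarith⟩
  have k1 := key 1 1 0 1 (by norm_num)
  have k2 := key 1 (-1) 0 1 (by norm_num)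
  have k3 := key 1 0 1 1 (by norm_num)
  have k4 := key 1 0 (-1) 1 (by norm_num)
  simp [Matrix.mul_apply, Fin.sum_univ_two, Matrix.transpose_apply, hsymm] at k1 k2 k3 k4
  have conj (P : (Matrix (Fin 2) (Fin 2) ℤ)ˣ) (g : G) :
      ((P⁻¹ : (Matrix (Fin 2) (Fin 2) ℤ)ˣ) * A g * P : Matrix (Fin 2) (Fin 2) ℤ)ᵀ * S P *
        ((P⁻¹ : (Matrix (Fin 2) (Fin 2) ℤ)ˣ) * A g * P) = S P := by
    rw [← hS, ← Matrix.mul_assoc, ← Matrix.mul_assoc, ← Units.val_mul, mul_inv_cancel,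
      Units.val_one, Matrix.one_mul, hSinv]
  have fin (P : (Matrix (Fin 2) (Fin 2) ℤ)ˣ) (h0 : 0 ≤ S P 0 1) (h1 : 2 * S P 0 1 ≤ S P 0 0)
      (h2 : 2 * S P 0 1 ≤ S P 1 1) : ∃ P Q : Matrix (Fin 2) (Fin 2) ℤ,
      P * Q = 1 ∧ Q * P = 1 ∧ ∃ a h c : ℤ, 0 < a ∧ 0 < c ∧ 0 ≤ h ∧ 2 * h ≤ a ∧ 2 * h ≤ c ∧
        ∀ g, (Q * A g * P)ᵀ * !![a, h; h, c] * (Q * A g * P) = !![a, h; h, c] := by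
    refine ⟨P, (P⁻¹ : (Matrix (Fin 2) (Fin 2) ℤ)ˣ), P.mul_inv, P.inv_mul, S P 0 0, S P 0 1,
      S P 1 1, hpos P P.isUnit 0, hpos P P.isUnit 1, h0, h1, h2, fun g => ?_⟩
    have : !![S P 0 0, S P 0 1; S P 0 1, S P 1 1] = S P := by
      conv_rhs => rw [Matrix.eta_fin_two (S P), hsymm]
    rw [this]
    exact conj P g
  rcases le_total 0 (S P 0 1) with h0 | h0
  · exact fin P h0 (by linarith) (by linarith)
  · let D : (Matrix (Fin 2) (Fin 2) ℤ)ˣ := ⟨!![1, 0; 0, -1], !![1, 0; 0, -1],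
      by simp [Matrix.one_fin_two], by simp [Matrix.one_fin_two]⟩
    have hD : S (P * D : (Matrix (Fin 2) (Fin 2) ℤ)ˣ) =
        !![S P 0 0, - S P 0 1; - S P 0 1, S P 1 1] := by
      rw [Units.val_mul, hS, Matrix.eta_fin_two (S P), hsymm]
      ext i j
      fin_cases i <;> fin_cases j <;>
        simp [D, Matrix.mul_apply, Fin.sum_univ_two, Matrix.transpose_apply]
    apply fin (P * D) <;> rw [hD] <;> simp <;> linarith

/-- The matrices of the symmetries of the square lattice, i.e. the signed permutation matrices. -/
def IsSquareSymmetry (B : Matrix (Fin 2) (Fin 2) ℤ) : Prop :=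
  (B 1 0 = 0 ∧ B 0 1 = 0 ∧ IsUnit (B 0 0) ∧ IsUnit (B 1 1)) ∨
    (B 0 0 = 0 ∧ B 1 1 = 0 ∧ IsUnit (B 1 0) ∧ IsUnit (B 0 1))

/-- The matrices preserving the quadratic form `x² + xy + y²` of the hexagonal lattice. -/
def IsHexagonalSymmetry (B : Matrix (Fin 2) (Fin 2) ℤ) : Prop :=
  B 0 0 ^ 2 + B 0 0 * B 1 0 + B 1 0 ^ 2 = 1 ∧ B 0 1 ^ 2 + B 0 1 * B 1 1 + B 1 1 ^ 2 = 1 ∧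
    2 * (B 0 0 * B 0 1) + (B 0 0 * B 1 1 + B 1 0 * B 0 1) + 2 * (B 1 0 * B 1 1) = 1

lemma exists_conj_square_or_hexagonal {G : Type*} [Group G] [Fintype G]
    (A : G →* Matrix (Fin 2) (Fin 2) ℤ) : ∃ P Q : Matrix (Fin 2) (Fin 2) ℤ,
      P * Q = 1 ∧ Q * P = 1 ∧
      ((∀ g, IsSquareSymmetry (Q * A g * P)) ∨ ∀ g, IsHexagonalSymmetry (Q * A g * P)) := by
  obtain ⟨P, Q, hPQ, hQP, a, h, c, ha, hc, h0, hha, hhc, hB⟩ := exists_reduced_gram A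
  have hdet (g : G) : IsUnit (Q * A g * P).det := by
    rw [← Matrix.isUnit_iff_isUnit_det]
    have hA : IsUnit (A g) := (Group.isUnit g).map A
    exact ((IsUnit.of_mul_eq_one P hQP).mul hA).mul (IsUnit.of_mul_eq_one Q hPQ)
  refine ⟨P, Q, hPQ, hQP, ?_⟩
  have ent (g : G) := And.intro (congrFun (congrFun (hB g) 0) 0) <|
    And.intro (congrFun (congrFun (hB g) 1) 1) (congrFun (congrFun (hB g) 0) 1)
  generalize hBg : (fun g => Q * A g * P) = B at *
  simp only [funext_iff] at hBg
  simp only [hBg] at *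
  simp only [Matrix.mul_apply, Fin.sum_univ_two, Matrix.transpose_apply, Matrix.of_apply,
    Matrix.cons_val_zero, Matrix.cons_val_one, Matrix.cons_val'] at ent
  simp only [Matrix.det_fin_two] at hdet
  by_cases hac : 2 * h = a ∨ 2 * h = c
  · right
    intro g
    obtain ⟨e1, e2, e3⟩ := ent g
    exact hexagonal_of_form ha hc hha hhc hac (by linarith) (by linarith) (by linarith)
      (by convert hdet g using 1; ring)
  · left
    push Not at hac
    intro g
    obtain ⟨e1, e2, e3⟩ := ent g
    exact signed_permutation_of_form ha hc h0 (lt_of_le_of_ne hha hac.1)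
      (lt_of_le_of_ne hhc hac.2) (by linarith) (by linarith) (by convert hdet g using 1; ring)

end Lattice

section Generation

variable {K L : Type*} [Field K] [Field L] [Algebra K L]

lemma adjoin_eq_top_of_mem {y t : Fin 2 → L} (hy : IntermediateField.adjoin K (Set.range y) = ⊤)
    (h0 : y 0 ∈ IntermediateField.adjoin K (Set.range t))
    (h1 : y 1 ∈ IntermediateField.adjoin K (Set.range t)) :
    IntermediateField.adjoin K (Set.range t) = ⊤ := by
  rw [eq_top_iff, ← hy, IntermediateField.adjoin_le_iff]
  rintro _ ⟨j, rfl⟩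
  fin_cases j
  exacts [h0, h1]

lemma algebraMap_ne_of_algebraicIndependent {y : Fin 2 → L} (hy : AlgebraicIndependent K y)
    (j : Fin 2) (c : K) : y j ≠ algebraMap K L c := by
  intro h
  exact hy.transcendental j (h ▸ isAlgebraic_algebraMap c)

lemma linear_ne_zero_of_algebraicIndependent {y : Fin 2 → L} (hy : AlgebraicIndependent K y)
    {a b c : K} (hab : a ≠ 0 ∨ b ≠ 0) :
    algebraMap K L a * y 0 + algebraMap K L b * y 1 + algebraMap K L c ≠ 0 := by
  intro h
  have h1 : (MvPolynomial.C a * X 0 + MvPolynomial.C b * X 1 + MvPolynomial.C c :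
      MvPolynomial (Fin 2) K) = 0 := by
    apply hy
    simpa [MvPolynomial.algebraMap_eq] using h
  have h2 (z w : K) := congrArg (MvPolynomial.eval ![z, w]) h1
  have e0 := h2 0 0
  have e1 := h2 1 0
  have e2 := h2 0 1
  simp at e0 e1 e2
  simp_all

end Generation

section Permutation

variable {k K L : Type*} [Field k] [Field K] [Field L] [Algebra k K] [Algebra k L]
  [FiniteDimensional k K]

lemma exists_equivariant_ne_of_hom (ρ : (K ≃ₐ[k] K) →* (L ≃ₐ[k] L)) {s t : L} (hst : s ≠ t) :
    ∃ f : L → K, (∀ g x, f (ρ g x) = g (f x)) ∧ f s ≠ f t :=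
  letI := MulAction.compHom L ρ
  exists_equivariant_ne hst

variable [Algebra K L] [IsScalarTower k K L] [IsGalois k K]

lemma isRational_of_permutation (ρ : (K ≃ₐ[k] K) →* (L ≃ₐ[k] L))
    (hext : ∀ σ c, ρ σ (algebraMap K L c) = algebraMap K L (σ c)) {x t : Fin 2 → L}
    (hx : AlgebraicIndependent K x) (ht : IntermediateField.adjoin K (Set.range t) = ⊤)
    (hperm : ∀ σ, (ρ σ (t 0) = t 0 ∧ ρ σ (t 1) = t 1) ∨ (ρ σ (t 0) = t 1 ∧ ρ σ (t 1) = t 0)) :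
    IsRational k (IntermediateField.fixedField ρ.range) := by
  have hne : t 0 ≠ t 1 :=
    fun h => zero_ne_one ((algebraicIndependent_of_adjoin_eq_top hx ht).injective h)
  obtain ⟨f, hf, hft⟩ := exists_equivariant_ne_of_hom ρ hne
  let u : Fin 2 → L :=
    ![t 0 + t 1, algebraMap K L (f (t 0)) * t 0 + algebraMap K L (f (t 1)) * t 1]
  have hd : algebraMap K L (f (t 0)) - algebraMap K L (f (t 1)) ≠ 0 := by
    rw [← map_sub]
    simpa [sub_eq_zero] using hft
  have hmem (j) : u j ∈ IntermediateField.adjoin K (Set.range u) :=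
    IntermediateField.subset_adjoin K _ ⟨j, rfl⟩
  have hc (c : K) : algebraMap K L c ∈ IntermediateField.adjoin K (Set.range u) :=
    IntermediateField.algebraMap_mem _ c
  refine isRational_fixedField ρ hext hx (u := u) (adjoin_eq_top_of_mem ht ?_ ?_) ?_
  · convert div_mem (sub_mem (hmem 1) (mul_mem (hc (f (t 1))) (hmem 0)))
      (sub_mem (hc (f (t 0))) (hc (f (t 1)))) using 1
    rw [eq_div_iff hd]
    simp [u]
    ring
  · convert div_mem (sub_mem (mul_mem (hc (f (t 0))) (hmem 0)) (hmem 1))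
      (sub_mem (hc (f (t 0))) (hc (f (t 1)))) using 1
    rw [eq_div_iff hd]
    simp [u]
    ring
  · intro σ j
    have h0 := hf σ (t 0)
    have h1 := hf σ (t 1)
    rcases hperm σ with ⟨e0, e1⟩ | ⟨e0, e1⟩ <;> rw [e0] at h0 <;> rw [e1] at h1 <;>
      fin_cases j <;> simp [u, e0, e1, hext, ← h0, ← h1, add_comm]

lemma isRational_of_square (ρ : (K ≃ₐ[k] K) →* (L ≃ₐ[k] L))
    (hext : ∀ σ c, ρ σ (algebraMap K L c) = algebraMap K L (σ c)) {y : Fin 2 → L}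
    (hy : AlgebraicIndependent K y) (htop : IntermediateField.adjoin K (Set.range y) = ⊤)
    (hsq : ∀ σ, ((ρ σ (y 0) = y 0 ∨ ρ σ (y 0) = (y 0)⁻¹) ∧
        (ρ σ (y 1) = y 1 ∨ ρ σ (y 1) = (y 1)⁻¹)) ∨
      ((ρ σ (y 0) = y 1 ∨ ρ σ (y 0) = (y 1)⁻¹) ∧ (ρ σ (y 1) = y 0 ∨ ρ σ (y 1) = (y 0)⁻¹))) :
    IsRational k (IntermediateField.fixedField ρ.range) := by
  have hy0 (j) : y j ≠ 0 := by simpa using algebraMap_ne_of_algebraicIndependent hy j 0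
  have hy1 (j) : y j + 1 ≠ 0 := by
    simpa [eq_neg_iff_add_eq_zero] using algebraMap_ne_of_algebraicIndependent hy j (-1)
  have hinv (j) : y j ≠ (y j)⁻¹ := by
    intro h
    have h2 : (y j - 1) * (y j + 1) = 0 := by
      linear_combination y j * h + mul_inv_cancel₀ (hy0 j)
    have h3 := (mul_eq_zero.1 h2).resolve_right (hy1 j)
    exact algebraMap_ne_of_algebraicIndependent hy j 1 (by simpa [sub_eq_zero] using h3)
  obtain ⟨f, hf, hfy⟩ : ∃ f : L → K, (∀ g x, f (ρ g x) = g (f x)) ∧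
      ∀ j, f (y j) ≠ f (y j)⁻¹ := by
    obtain ⟨f₀, hf₀, h0⟩ := exists_equivariant_ne_of_hom ρ (hinv 0)
    obtain ⟨f₁, hf₁, h1⟩ := exists_equivariant_ne_of_hom ρ (hinv 1)
    by_cases h01 : f₀ (y 1) = f₀ (y 1)⁻¹
    · by_cases h10 : f₁ (y 0) = f₁ (y 0)⁻¹
      · refine ⟨f₀ + f₁, by simp [hf₀, hf₁], fun j => ?_⟩
        fin_cases j
        · simpa [h10] using h0
        · simpa [h01] using h1
      · exact ⟨f₁, hf₁, Fin.forall_fin_two.2 ⟨h10, h1⟩⟩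
    · exact ⟨f₀, hf₀, Fin.forall_fin_two.2 ⟨h0, h01⟩⟩
  let T (z : L) : L := (algebraMap K L (f z) * z + algebraMap K L (f z⁻¹)) / (z + 1)
  have hT (σ z) : ρ σ (T z) = T (ρ σ z) := by
    simp [T, hext, ← hf]
  have hTinv (j) : T (y j)⁻¹ = T (y j) := by
    have h1 := hy1 j
    have h2 := hy0 j
    have h3 : (y j)⁻¹ + 1 ≠ 0 := by
      intro h
      apply h1
      field_simp at h
      linear_combination h
    simp only [T, inv_inv]
    rw [div_eq_div_iff h3 h1]
    field_simp
    ring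
  have hd (j) : T (y j) - algebraMap K L (f (y j)) ≠ 0 := by
    have h1 := hy1 j
    have h2 : T (y j) - algebraMap K L (f (y j)) =
        algebraMap K L (f (y j)⁻¹ - f (y j)) / (y j + 1) := by
      simp only [T, map_sub]
      field_simp
      ring
    rw [h2]
    exact div_ne_zero (by simpa [sub_eq_zero] using (hfy j).symm) h1
  have hrec (j) : y j = (algebraMap K L (f (y j)⁻¹) - T (y j)) /
      (T (y j) - algebraMap K L (f (y j))) := by
    rw [eq_div_iff (hd j)]
    have h1 := hy1 j
    simp only [T]
    field_simp
    ring
  have hmem (j : Fin 2) :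
      y j ∈ IntermediateField.adjoin K (Set.range fun j => T (y j)) := by
    rw [hrec j]
    have : T (y j) ∈ IntermediateField.adjoin K (Set.range fun j => T (y j)) :=
      IntermediateField.subset_adjoin K _ ⟨j, rfl⟩
    exact div_mem (sub_mem (IntermediateField.algebraMap_mem _ _) this)
      (sub_mem this (IntermediateField.algebraMap_mem _ _))
  refine isRational_of_permutation ρ hext hy (t := fun j => T (y j))
    (adjoin_eq_top_of_mem htop (hmem 0) (hmem 1)) fun σ => ?_
  simp only [hT]
  rcases hsq σ with ⟨h0 | h0, h1 | h1⟩ | ⟨h0 | h0, h1 | h1⟩ <;> simp [h0, h1, hTinv]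

end Permutation

section Hexagonal

lemma hexagonal_vector_cases {x y : ℤ} (h : x ^ 2 + x * y + y ^ 2 = 1) :
    (x = 1 ∧ y = 0) ∨ (x = 0 ∧ y = 1) ∨ (x = 1 ∧ y = -1) ∨ (x = -1 ∧ y = 0) ∨
      (x = 0 ∧ y = -1) ∨ (x = -1 ∧ y = 1) := by
  have hx : -1 ≤ x ∧ x ≤ 1 := by
    constructor <;> nlinarith [sq_nonneg (x + 2 * y)]
  have hy : -1 ≤ y ∧ y ≤ 1 := by
    constructor <;> nlinarith [sq_nonneg (2 * x + y)]
  obtain ⟨hx1, hx2⟩ := hx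
  obtain ⟨hy1, hy2⟩ := hy
  interval_cases x <;> interval_cases y <;> simp_all

/-- The effect of a hexagonal symmetry `B` of the torus on the functions `y i - 1` vanishing at
the origin: up to a common factor it is given by the matrix `B` itself, possibly followed by
the inversion of the torus. -/
lemma exists_monomial_sub_one_eq {L : Type*} [Field L] {y : Fin 2 → L} (hy : ∀ j, y j ≠ 0)
    {B : Matrix (Fin 2) (Fin 2) ℤ} (hB : IsHexagonalSymmetry B) :
    ∃ (z : Fin 2 → L) (l l' : L), (z = y ∨ z = y⁻¹) ∧ l ≠ 0 ∧ l' ≠ 0 ∧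
      ∀ j, (∏ i, y i ^ B i j) - 1 = l * (B 0 j * (z 0 - 1) + B 1 j * (z 1 - 1)) ∧
        (∏ i, y i ^ B i j)⁻¹ - 1 = l' * (B 0 j * ((z 0)⁻¹ - 1) + B 1 j * ((z 1)⁻¹ - 1)) := by
  obtain ⟨h0, h1, h2⟩ := hB
  have hy0 := hy 0
  have hy1 := hy 1
  simp only [Fin.prod_univ_two, Fin.forall_fin_two]
  generalize B 0 0 = p, B 0 1 = s, B 1 0 = r, B 1 1 = t at *
  rcases hexagonal_vector_cases h0 with ⟨rfl, rfl⟩ | ⟨rfl, rfl⟩ | ⟨rfl, rfl⟩ | ⟨rfl, rfl⟩ |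
    ⟨rfl, rfl⟩ | ⟨rfl, rfl⟩ <;>
  rcases hexagonal_vector_cases h1 with ⟨rfl, rfl⟩ | ⟨rfl, rfl⟩ | ⟨rfl, rfl⟩ | ⟨rfl, rfl⟩ |
    ⟨rfl, rfl⟩ | ⟨rfl, rfl⟩ <;>
  first
  | (exfalso; revert h2; decide)
  | (refine ⟨y, 1, 1, Or.inl rfl, one_ne_zero, one_ne_zero, ⟨?_, ?_⟩, ?_, ?_⟩ <;>
      simp; done)
  | (refine ⟨y, (y 0)⁻¹, y 0, Or.inl rfl, inv_ne_zero hy0, hy0, ⟨?_, ?_⟩, ?_, ?_⟩ <;>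
      simp <;> field_simp; done)
  | (refine ⟨y, (y 1)⁻¹, y 1, Or.inl rfl, inv_ne_zero hy1, hy1, ⟨?_, ?_⟩, ?_, ?_⟩ <;>
      simp <;> field_simp; done)
  | (refine ⟨y⁻¹, - y 0, -(y 0)⁻¹, Or.inr rfl, neg_ne_zero.2 hy0,
        neg_ne_zero.2 (inv_ne_zero hy0), ⟨?_, ?_⟩, ?_, ?_⟩ <;>
      simp <;> field_simp <;> ring1)
  | (refine ⟨y⁻¹, - y 1, -(y 1)⁻¹, Or.inr rfl, neg_ne_zero.2 hy1,
        neg_ne_zero.2 (inv_ne_zero hy1), ⟨?_, ?_⟩, ?_, ?_⟩ <;>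
      simp <;> field_simp <;> ring1)
  | (refine ⟨y⁻¹, -1, -1, Or.inr rfl, neg_ne_zero.2 one_ne_zero,
        neg_ne_zero.2 one_ne_zero, ⟨?_, ?_⟩, ?_, ?_⟩ <;>
      simp)

variable {k K L : Type*} [Field k] [Field K] [Field L] [Algebra k K] [Algebra K L] [Algebra k L]
  [IsScalarTower k K L] [FiniteDimensional k K]

/-- Hilbert's theorem 90 for `GL₂`, for cocycles that are homomorphisms to `GL₂(ℤ)`. -/
lemma exists_fixed_basis (A : (K ≃ₐ[k] K) →* Matrix (Fin 2) (Fin 2) ℤ) :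
    ∃ c d : Fin 2 → K, (∀ σ i, A σ i 0 * σ (c 0) + A σ i 1 * σ (c 1) = c i) ∧
      (∀ σ i, A σ i 0 * σ (d 0) + A σ i 1 * σ (d 1) = d i) ∧ c 0 * d 1 - c 1 * d 0 ≠ 0 := by
  let S (σ : K ≃ₐ[k] K) : (Fin 2 → K) →+ (Fin 2 → K) :=
    { toFun := fun v i => A σ i 0 * σ (v 0) + A σ i 1 * σ (v 1)
      map_zero' := by ext; simp
      map_add' := by intros; ext; simp; ring }
  have hS (σ v i) : S σ v i = A σ i 0 * σ (v 0) + A σ i 1 * σ (v 1) := rfl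
  have h1 (v) : S 1 v = v := by
    ext i
    fin_cases i <;> simp [hS]
  have hmul (σ τ v) : S (σ * τ) v = S σ (S τ v) := by
    ext i
    simp [hS, Matrix.mul_apply]
    ring
  have hsmul (σ) (c : K) (v) : S σ (c • v) = σ c • S σ v := by
    ext i
    simp [hS]
    ring
  obtain ⟨c, hc, hc0⟩ := exists_fixed_ne_zero S h1 hmul hsmul
    (LinearMap.proj (R := K) (φ := fun _ : Fin 2 => K) 0) (v := ![1, 0]) (by simp)
  obtain ⟨d, hd, hcd⟩ := exists_fixed_ne_zero S h1 hmul hsmul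
    (c 0 • LinearMap.proj (R := K) (φ := fun _ : Fin 2 => K) 1 - c 1 • LinearMap.proj 0)
    (v := ![0, 1]) (by simpa using hc0)
  exact ⟨c, d, fun σ i => congrFun (hc σ) i, fun σ i => congrFun (hd σ) i, by simpa using hcd⟩

lemma isRational_of_hexagonal [IsGalois k K] (ρ : (K ≃ₐ[k] K) →* (L ≃ₐ[k] L))
    (hext : ∀ σ c, ρ σ (algebraMap K L c) = algebraMap K L (σ c)) {y : Fin 2 → L}
    (hy : AlgebraicIndependent K y) (htop : IntermediateField.adjoin K (Set.range y) = ⊤)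
    (A : (K ≃ₐ[k] K) →* Matrix (Fin 2) (Fin 2) ℤ) (hA : ∀ σ j, ρ σ (y j) = ∏ i, y i ^ A σ i j)
    (hhex : ∀ σ, IsHexagonalSymmetry (A σ)) :
    IsRational k (IntermediateField.fixedField ρ.range) := by
  have hy0 (j) : y j ≠ 0 := by simpa using algebraMap_ne_of_algebraicIndependent hy j 0
  have hy1 (j) : y j - 1 ≠ 0 := by
    simpa [sub_eq_zero] using algebraMap_ne_of_algebraicIndependent hy j 1
  have hinv_mem (j : Fin 2) : y j ∈ IntermediateField.adjoin K (Set.range y⁻¹) := by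
    rw [← inv_inv (y j)]
    exact inv_mem (IntermediateField.subset_adjoin K _ ⟨j, rfl⟩)
  have hy' : AlgebraicIndependent K y⁻¹ := algebraicIndependent_of_adjoin_eq_top hy
    (adjoin_eq_top_of_mem htop (hinv_mem 0) (hinv_mem 1))
  obtain ⟨c, d, hc, hd, hcd⟩ := exists_fixed_basis A
  let N (v : Fin 2 → K) (z : Fin 2 → L) : L :=
    algebraMap K L (v 0) * (z 0 - 1) + algebraMap K L (v 1) * (z 1 - 1)
  have hN (v : Fin 2 → K) (hv : v 0 ≠ 0 ∨ v 1 ≠ 0) {z : Fin 2 → L}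
      (hz : AlgebraicIndependent K z) : N v z ≠ 0 := by
    convert linear_ne_zero_of_algebraicIndependent hz hv (c := -(v 0 + v 1)) using 1
    simp [N]
    ring
  have hd0 : d 0 ≠ 0 ∨ d 1 ≠ 0 := by
    by_contra! h
    simp [h.1, h.2] at hcd
  have hNd := hN d hd0 hy
  have hNd' := hN d hd0 hy'
  have hρ (σ) : ∃ (z : Fin 2 → L) (l l' : L), (z = y ∨ z = y⁻¹) ∧ l ≠ 0 ∧ l' ≠ 0 ∧
      ∀ v : Fin 2 → K, (∀ i, A σ i 0 * σ (v 0) + A σ i 1 * σ (v 1) = v i) →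
        ρ σ (N v y) = l * N v z ∧ ρ σ (N v y⁻¹) = l' * N v z⁻¹ := by
    obtain ⟨z, l, l', hz, hl, hl', h⟩ := exists_monomial_sub_one_eq hy0 (hhex σ)
    refine ⟨z, l, l', hz, hl, hl', fun v hv => ?_⟩
    have hv' (i) := congrArg (algebraMap K L) (hv i)
    simp only [map_add, map_mul, map_intCast] at hv'
    simp only [N, map_add, map_mul, map_sub, map_one, hext, Pi.inv_apply, map_inv₀, hA]
    rw [← hv' 0, ← hv' 1, (h 0).1, (h 0).2, (h 1).1, (h 1).2]
    constructor <;> ring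
  let t : Fin 2 → L := ![N c y / N d y, N c y⁻¹ / N d y⁻¹]
  have hmemt (j) : t j ∈ IntermediateField.adjoin K (Set.range t) :=
    IntermediateField.subset_adjoin K _ ⟨j, rfl⟩
  have halg (a : K) : algebraMap K L a ∈ IntermediateField.adjoin K (Set.range t) :=
    IntermediateField.algebraMap_mem _ a
  set F := IntermediateField.adjoin K (Set.range t)
  have hcd' : algebraMap K L (c 0) * algebraMap K L (d 1) -
      algebraMap K L (c 1) * algebraMap K L (d 0) ≠ 0 := by
    rw [← map_mul, ← map_mul, ← map_sub]
    exact (map_ne_zero (algebraMap K L)).2 hcd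
  have hslope {z : Fin 2 → L} (hz1 : z 1 - 1 ≠ 0) (hz : N d z ≠ 0) (h : N c z / N d z ∈ F) :
      (z 0 - 1) / (z 1 - 1) ∈ F := by
    have h1 : algebraMap K L (c 0) - N c z / N d z * algebraMap K L (d 0) ≠ 0 := by
      have : algebraMap K L (c 0) - N c z / N d z * algebraMap K L (d 0) =
          (algebraMap K L (c 0) * algebraMap K L (d 1) -
            algebraMap K L (c 1) * algebraMap K L (d 0)) * (z 1 - 1) / N d z := by
        field_simp
        simp only [N]
        ring
      rw [this]
      exact div_ne_zero (mul_ne_zero hcd' hz1) hz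
    convert div_mem (sub_mem (mul_mem h (halg (d 1))) (halg (c 1)))
      (sub_mem (halg (c 0)) (mul_mem h (halg (d 0)))) using 1
    rw [div_eq_div_iff hz1 h1]
    field_simp
    simp only [N]
    ring
  have hyinv (j) : (y j)⁻¹ - 1 ≠ 0 := by
    simpa [sub_eq_zero] using sub_ne_zero.1 (hy1 j)
  have hu := hslope (hy1 1) hNd (hmemt 0)
  have hv := hslope (z := y⁻¹) (hyinv 1) hNd' (hmemt 1)
  set u := (y 0 - 1) / (y 1 - 1) with hu_def
  have hr : y 0 / y 1 ∈ F := by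
    have hinv (j) : (y j)⁻¹ - 1 = -(y j - 1) / y j := by
      have := hy0 j
      field_simp
      ring
    have h1 := hy1 0
    have h2 := hy1 1
    have h3 := hy0 0
    have h4 := hy0 1
    convert div_mem hu hv using 1
    rw [Pi.inv_apply, Pi.inv_apply, hinv, hinv, hu_def]
    field_simp
  have hy1F : y 1 ∈ F := by
    have h1 := hy1 1
    have h5 := hy0 1
    have hne : y 0 - y 1 ≠ 0 := by
      simpa [← sub_eq_add_neg] using
        linear_ne_zero_of_algebraicIndependent hy (a := 1) (b := -1) (c := 0) (by simp)
    have h2 : u - y 0 / y 1 = (y 0 - y 1) / (y 1 * (y 1 - 1)) := by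
      rw [hu_def]
      field_simp
      ring
    have h3 : u - y 0 / y 1 ≠ 0 := by
      rw [h2]
      exact div_ne_zero hne (mul_ne_zero h5 h1)
    convert div_mem (sub_mem hu (one_mem F)) (sub_mem hu hr) using 1
    rw [eq_div_iff h3, h2, hu_def]
    field_simp
    ring
  have hy0F : y 0 ∈ F := by
    convert mul_mem hr hy1F using 1
    rw [div_mul_cancel₀ _ (hy0 1)]
  refine isRational_of_permutation ρ hext hy (t := t)
    (adjoin_eq_top_of_mem htop hy0F hy1F) fun σ => ?_
  obtain ⟨z, l, l', hz, hl, hl', h⟩ := hρ σ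
  have hc' := h c (hc σ)
  have hd' := h d (hd σ)
  have e0 : ρ σ (t 0) = N c z / N d z := by
    simp [t, hc'.1, hd'.1, mul_div_mul_left _ _ hl]
  have e1 : ρ σ (t 1) = N c z⁻¹ / N d z⁻¹ := by
    simp [t, hc'.2, hd'.2, mul_div_mul_left _ _ hl']
  rw [e0, e1]
  rcases hz with rfl | rfl
  · left; exact ⟨rfl, rfl⟩
  · right; rw [inv_inv]; exact ⟨rfl, rfl⟩

end Hexagonal

section Monomial

/-- The monomials in `x` whose exponent vectors are the columns of `P`. -/
def monomialFamily {L : Type*} [Field L] (x : Fin 2 → L) (P : Matrix (Fin 2) (Fin 2) ℤ) :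
    Fin 2 → L := fun j => ∏ i, x i ^ P i j

lemma monomialFamily_one {L : Type*} [Field L] (x : Fin 2 → L) : monomialFamily x 1 = x := by
  ext j
  fin_cases j <;> simp [monomialFamily, Matrix.one_apply]

lemma monomialFamily_mul {L : Type*} [Field L] {x : Fin 2 → L} (hx : ∀ j, x j ≠ 0)
    (P Q : Matrix (Fin 2) (Fin 2) ℤ) :
    monomialFamily x (P * Q) = monomialFamily (monomialFamily x P) Q := by
  ext j
  simp only [monomialFamily, Fin.prod_univ_two, Matrix.mul_apply, Fin.sum_univ_two,
    zpow_add₀ (hx _), zpow_mul, mul_zpow]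
  ring

lemma map_monomialFamily {L M F : Type*} [Field L] [Field M] [FunLike F L M] [RingHomClass F L M]
    (f : F) (x : Fin 2 → L) (P : Matrix (Fin 2) (Fin 2) ℤ) (j : Fin 2) :
    f (monomialFamily x P j) = monomialFamily (f ∘ x) P j := by
  simp [monomialFamily, map_zpow₀]

variable {K L : Type*} [Field K] [Field L] [Algebra K L]

lemma zpow_mul_zpow_eq_one_iff {x : Fin 2 → L} (hx : AlgebraicIndependent K x) {a b : ℤ} :
    x 0 ^ a * x 1 ^ b = 1 ↔ a = 0 ∧ b = 0 := by
  refine ⟨fun h => ?_, fun h => by simp [h.1, h.2]⟩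
  have hx0 (j) : x j ≠ 0 := by simpa using algebraMap_ne_of_algebraicIndependent hx j 0
  obtain ⟨a₁, a₂, rfl⟩ : ∃ m n : ℕ, a = m - n := ⟨_, _, (Int.toNat_sub_toNat_neg a).symm⟩
  obtain ⟨b₁, b₂, rfl⟩ : ∃ m n : ℕ, b = m - n := ⟨_, _, (Int.toNat_sub_toNat_neg b).symm⟩
  have h0 := hx0 0
  have h1 := hx0 1
  simp only [zpow_sub₀ h0, zpow_sub₀ h1, zpow_natCast] at h
  have h2 : x 0 ^ a₁ * x 1 ^ b₁ = x 0 ^ a₂ * x 1 ^ b₂ := by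
    field_simp at h
    exact h
  have h3 : (monomial (Finsupp.single 0 a₁ + Finsupp.single 1 b₁) 1 : MvPolynomial (Fin 2) K) =
      monomial (Finsupp.single 0 a₂ + Finsupp.single 1 b₂) 1 := by
    apply hx
    simpa [aeval_monomial, Finsupp.prod_fintype] using h2
  have h4 := monomial_left_injective (one_ne_zero (α := K)) h3
  have h5 := DFunLike.congr_fun h4 0
  have h6 := DFunLike.congr_fun h4 1
  simp at h5 h6
  simp [h5, h6]

lemma monomialFamily_injective {x : Fin 2 → L} (hx : AlgebraicIndependent K x) :
    Function.Injective (monomialFamily x) := by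
  intro P Q h
  have hx0 (j) : x j ≠ 0 := by simpa using algebraMap_ne_of_algebraicIndependent hx j 0
  have key (j) : P 0 j - Q 0 j = 0 ∧ P 1 j - Q 1 j = 0 := by
    rw [← zpow_mul_zpow_eq_one_iff hx, zpow_sub₀ (hx0 0), zpow_sub₀ (hx0 1)]
    have h1 := congrFun h j
    simp only [monomialFamily, Fin.prod_univ_two] at h1
    rw [div_mul_div_comm, h1, div_self]
    exact mul_ne_zero (zpow_ne_zero _ (hx0 0)) (zpow_ne_zero _ (hx0 1))
  ext i j
  fin_cases i
  exacts [sub_eq_zero.1 (key j).1, sub_eq_zero.1 (key j).2]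

lemma monomialFamily_mem {E : IntermediateField K L} {x : Fin 2 → L} (hx : ∀ j, x j ∈ E)
    (P : Matrix (Fin 2) (Fin 2) ℤ) (j : Fin 2) : monomialFamily x P j ∈ E :=
  prod_mem fun i _ => zpow_mem (hx i) _

variable {k : Type*} [Field k] [Algebra k K] [Algebra k L] [IsScalarTower k K L]
  [IsGalois k K] [FiniteDimensional k K]

/-- The fixed field of a purely quasi-monomial action on a field generated by two algebraically
independent elements is rational. -/
lemma isRational_of_monomial (ρ : (K ≃ₐ[k] K) →* (L ≃ₐ[k] L))
    (hext : ∀ σ c, ρ σ (algebraMap K L c) = algebraMap K L (σ c)) {x : Fin 2 → L}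
    (hx : AlgebraicIndependent K x) (htop : IntermediateField.adjoin K (Set.range x) = ⊤)
    (hmono : ∀ σ, ∃ A, ρ σ ∘ x = monomialFamily x A) :
    IsRational k (IntermediateField.fixedField ρ.range) := by
  have hx0 (j) : x j ≠ 0 := by simpa using algebraMap_ne_of_algebraicIndependent hx j 0
  choose A hA using hmono
  have hρ (σ P) : ρ σ ∘ monomialFamily x P = monomialFamily x (A σ * P) := by
    rw [monomialFamily_mul hx0, ← hA]
    ext j
    exact map_monomialFamily _ _ _ _
  have hA1 : A 1 = 1 := by
    apply monomialFamily_injective hx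
    rw [← hA, monomialFamily_one, map_one]
    rfl
  have hAmul (σ τ) : A (σ * τ) = A σ * A τ := by
    apply monomialFamily_injective hx
    rw [← hρ, ← hA, ← hA, map_mul]
    rfl
  obtain ⟨P, Q, hPQ, hQP, h⟩ :=
    exists_conj_square_or_hexagonal ({ toFun := A, map_one' := hA1, map_mul' := hAmul } :
      (K ≃ₐ[k] K) →* Matrix (Fin 2) (Fin 2) ℤ)
  let B : (K ≃ₐ[k] K) →* Matrix (Fin 2) (Fin 2) ℤ :=
    { toFun := fun σ => Q * A σ * P
      map_one' := by rw [hA1, mul_one, hQP]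
      map_mul' := fun σ τ => by
        rw [hAmul]
        calc Q * (A σ * A τ) * P = Q * A σ * 1 * (A τ * P) := by noncomm_ring
          _ = _ := by rw [← hPQ]; noncomm_ring }
  let y := monomialFamily x P
  have hyx : monomialFamily y Q = x := by
    rw [← monomialFamily_mul hx0, hPQ, monomialFamily_one]
  have hmem (j) : x j ∈ IntermediateField.adjoin K (Set.range y) := by
    nth_rw 1 [← hyx]
    exact monomialFamily_mem
      (fun i => IntermediateField.subset_adjoin K _ (Set.mem_range_self i)) Q j
  have hytop := adjoin_eq_top_of_mem htop (hmem 0) (hmem 1)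
  have hy := algebraicIndependent_of_adjoin_eq_top hx hytop
  have hB (σ j) : ρ σ (y j) = ∏ i, y i ^ B σ i j := by
    change (ρ σ ∘ monomialFamily x P) j = monomialFamily y (Q * A σ * P) j
    rw [hρ, mul_assoc, ← monomialFamily_mul hx0, ← mul_assoc, hPQ, one_mul]
  rcases h with h | h
  · refine isRational_of_square ρ hext hy hytop fun σ => ?_
    have hσ : IsSquareSymmetry (B σ) := h σ
    rw [hB, hB, Fin.prod_univ_two, Fin.prod_univ_two]
    rcases hσ with ⟨h1, h2, h3, h4⟩ | ⟨h1, h2, h3, h4⟩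
    · left
      rw [h1, h2]
      rcases Int.isUnit_iff.1 h3 with h3 | h3 <;> rcases Int.isUnit_iff.1 h4 with h4 | h4 <;>
        simp [h3, h4]
    · right
      rw [h1, h2]
      rcases Int.isUnit_iff.1 h3 with h3 | h3 <;> rcases Int.isUnit_iff.1 h4 with h4 | h4 <;>
        simp [h3, h4]
  · exact isRational_of_hexagonal ρ hext hy hytop B hB h

end Monomial

lemma adjoin_range_algebraMap_X (K : Type*) [Field K] (ι : Type*) :
    IntermediateField.adjoin K (Set.range fun j : ι =>
      algebraMap (MvPolynomial ι K) (FractionRing (MvPolynomial ι K)) (X j)) = ⊤ := by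
  set E := IntermediateField.adjoin K (Set.range fun j : ι =>
      algebraMap (MvPolynomial ι K) (FractionRing (MvPolynomial ι K)) (X j)) with hE
  have hpoly (p : MvPolynomial ι K) :
      algebraMap (MvPolynomial ι K) (FractionRing (MvPolynomial ι K)) p ∈ E := by
    induction p using MvPolynomial.induction_on with
    | C a =>
      rw [← MvPolynomial.algebraMap_eq, ← IsScalarTower.algebraMap_apply]
      exact E.algebraMap_mem a
    | add p q hp hq => rw [map_add]; exact add_mem hp hq
    | mul_X p j hp =>
      rw [map_mul]
      exact mul_mem hp (IntermediateField.subset_adjoin K _ ⟨j, rfl⟩)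
  rw [eq_top_iff]
  intro z _
  obtain ⟨p, q, -, rfl⟩ := IsFractionRing.div_surjective (A := MvPolynomial ι K) z
  exact div_mem (hpoly p) (hpoly q)

lemma algebraicIndependent_algebraMap_X (K : Type*) [Field K] (ι : Type*) :
    AlgebraicIndependent K (fun j : ι =>
      algebraMap (MvPolynomial ι K) (FractionRing (MvPolynomial ι K)) (X j)) :=
  (MvPolynomial.algebraicIndependent_X ι K).map'
    (f := IsScalarTower.toAlgHom K (MvPolynomial ι K) (FractionRing (MvPolynomial ι K)))
    (IsFractionRing.injective _ _)

/-- **Voskresenskii.** Let `K/k` be a finite Galois extension with group `G = Gal(K/k)` and let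
`G` act on `K(x₁,x₂)` extending its action on `K`, purely quasi-monomially: each `σ ∈ G` sends
each variable `x_j` to a monomial `x₁^{a₁ⱼ(σ)} x₂^{a₂ⱼ(σ)}` with `[a_{ij}(σ)] ∈ GL₂(ℤ)`.
Then the fixed field `K(x₁,x₂)^G` is `k`-rational (every two-dimensional algebraic `k`-torus
is `k`-rational). -/
theorem two_dimensional_torus_rational
    (k K : Type*) [Field k] [Field K] [Algebra k K] [IsGalois k K] [FiniteDimensional k K]
    (ρ : (K ≃ₐ[k] K) →*
      (FractionRing (MvPolynomial (Fin 2) K) ≃ₐ[k] FractionRing (MvPolynomial (Fin 2) K)))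
    (hext : ∀ (σ : K ≃ₐ[k] K) (c : K),
      ρ σ (algebraMap K (FractionRing (MvPolynomial (Fin 2) K)) c) =
        algebraMap K (FractionRing (MvPolynomial (Fin 2) K)) (σ c))
    (hmono : ∀ σ : K ≃ₐ[k] K, ∃ A : Matrix (Fin 2) (Fin 2) ℤ, IsUnit A.det ∧
      ∀ j : Fin 2, ρ σ (algebraMap (MvPolynomial (Fin 2) K) _ (X j)) =
        ∏ i : Fin 2, (algebraMap (MvPolynomial (Fin 2) K) _ (X i)) ^ (A i j)) :
    IsRational k (IntermediateField.fixedField ρ.range) := by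
  exact isRational_of_monomial ρ hext (algebraicIndependent_algebraMap_X K (Fin 2))
    (adjoin_range_algebraMap_X K (Fin 2)) fun σ => (hmono σ).imp fun A hA => funext hA.2
end
end

section
/- Let G be a finite abelian group of exponent e, and let k be a field such that (i) either char k = 0 or char k = p > 0 with p not dividing e, and (ii) k contains a primitive e-th root of unity. Then the Noether invariant field k(G) is k-rational. -/
open MvPolynomial

noncomputable section

section LaurentMonomial

variable {ι K : Type*} [Fintype ι] [Field K]

/-- The Laurent monomial `∏ i, y i ^ a i`. -/
def laurentMonomial (y : ι → K) (a : ι → ℤ) : K := ∏ i, y i ^ a i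

theorem laurentMonomial_zero (y : ι → K) : laurentMonomial y 0 = 1 := by
  simp [laurentMonomial]

theorem laurentMonomial_add {y : ι → K} (hy : ∀ i, y i ≠ 0) (a b : ι → ℤ) :
    laurentMonomial y (a + b) = laurentMonomial y a * laurentMonomial y b := by
  simp [laurentMonomial, zpow_add₀ (hy _), Finset.prod_mul_distrib]

theorem laurentMonomial_single [DecidableEq ι] (y : ι → K) (i : ι) (n : ℤ) :
    laurentMonomial y (Pi.single i n) = y i ^ n := by
  rw [laurentMonomial, Finset.prod_eq_single i] <;> simp +contextual

theorem laurentMonomial_zsmul (y : ι → K) (n : ℤ) (a : ι → ℤ) :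
    laurentMonomial y (n • a) = laurentMonomial y a ^ n := by
  simp [laurentMonomial, ← Finset.prod_zpow, ← zpow_mul, mul_comm]

theorem laurentMonomial_sum {κ : Type*} {y : ι → K} (hy : ∀ i, y i ≠ 0) (s : Finset κ)
    (a : κ → ι → ℤ) :
    laurentMonomial y (∑ j ∈ s, a j) = ∏ j ∈ s, laurentMonomial y (a j) := by
  classical
  induction s using Finset.induction_on with
  | empty => simp [laurentMonomial_zero]
  | insert j s hj ih => rw [Finset.sum_insert hj, Finset.prod_insert hj, laurentMonomial_add hy, ih]

end LaurentMonomial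

section DiagonalAction

variable {k K G ι : Type*} [Field k] [Field K] [Algebra k K] [CommGroup G] [Fintype ι]

instance MonoidHom.instIntModuleAdditive (M A : Type*) [MulOneClass M] [CommGroup A] :
    Module ℤ (Additive (M →* A)) :=
  AddCommGroup.toIntModule _

/-- The homomorphism sending an exponent vector `a` to the character `∏ i, χ i ^ a i`. -/
def weight (χ : ι → G →* kˣ) : (ι → ℤ) →ₗ[ℤ] Additive (G →* kˣ) :=
  Fintype.linearCombination ℤ fun i ↦ Additive.ofMul (χ i)

theorem toMul_weight_apply (χ : ι → G →* kˣ) (a : ι → ℤ) (g : G) :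
    (weight χ a).toMul g = ∏ i, χ i g ^ a i := by
  simp [weight, Fintype.linearCombination_apply, toMul_sum, MonoidHom.finsetProd_apply]

theorem single_card_mem_ker_weight [DecidableEq ι] (χ : ι → G →* kˣ) (i : ι) :
    (Pi.single i (Nat.card G : ℤ) : ι → ℤ) ∈ LinearMap.ker (weight χ) := by
  rw [LinearMap.mem_ker]
  apply Additive.toMul.injective
  ext g
  rw [toMul_weight_apply, Finset.prod_eq_single i]
  · simp [← map_pow]
  · simp +contextual
  · simp

variable {ρ : G →* (K ≃ₐ[k] K)} {y : ι → K} {χ : ι → G →* kˣ}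

theorem map_laurentMonomial (hρ : ∀ g i, ρ g (y i) = (χ i g : k) • y i) (g : G) (a : ι → ℤ) :
    ρ g (laurentMonomial y a) = ((weight χ a).toMul g : k) • laurentMonomial y a := by
  simp [laurentMonomial, toMul_weight_apply, hρ, Algebra.smul_def, mul_zpow,
    Finset.prod_mul_distrib, map_prod, Units.coe_prod]

theorem sum_map_laurentMonomial_mem [Fintype G] (hρ : ∀ g i, ρ g (y i) = (χ i g : k) • y i)
    {E : IntermediateField k K}
    (hE : ∀ a ∈ LinearMap.ker (weight χ), laurentMonomial y a ∈ E) (a : ι → ℤ) :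
    ∑ g, ρ g (laurentMonomial y a) ∈ E := by
  by_cases ha : a ∈ LinearMap.ker (weight χ)
  · have h (g : G) : ρ g (laurentMonomial y a) = laurentMonomial y a := by
      rw [map_laurentMonomial hρ, LinearMap.mem_ker.1 ha]
      simp
    simp only [h]
    exact sum_mem fun _ _ ↦ hE a ha
  · have h : ∑ g, ((weight χ a).toMul g : k) = 0 := by
      refine sum_hom_units_eq_zero ((Units.coeHom k).comp (weight χ a).toMul) fun h ↦ ha ?_
      rw [LinearMap.mem_ker]
      apply Additive.toMul.injective
      ext g
      exact DFunLike.congr_fun h g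
    simp only [map_laurentMonomial hρ, ← Finset.sum_smul, h, zero_smul]
    exact zero_mem _

theorem exists_laurentMonomial_of_mem_closure (hy : ∀ i, y i ≠ 0) {f : K}
    (hf : f ∈ Submonoid.closure (Set.range y)) : ∃ a, f = laurentMonomial y a := by
  classical
  induction hf using Submonoid.closure_induction with
  | mem _ h =>
    obtain ⟨i, rfl⟩ := h
    exact ⟨Pi.single i 1, by simp [laurentMonomial_single]⟩
  | one => exact ⟨0, (laurentMonomial_zero y).symm⟩
  | mul _ _ _ _ h₁ h₂ =>
    obtain ⟨a, rfl⟩ := h₁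
    obtain ⟨b, rfl⟩ := h₂
    exact ⟨a + b, (laurentMonomial_add hy a b).symm⟩

variable [Finite G]

/-- If an intermediate field `E` of the fixed field contains all invariant Laurent monomials
in the eigenvectors `y i`, and `K` is generated by the `y i` over `E` as an algebra, then `E` is
the fixed field. -/
theorem fixedField_eq_of_laurentMonomial_mem (hcard : (Nat.card G : k) ≠ 0)
    (hy : ∀ i, y i ≠ 0) (hρ : ∀ g i, ρ g (y i) = (χ i g : k) • y i)
    {E : IntermediateField k K} (hle : E ≤ IntermediateField.fixedField ρ.range)
    (hE : ∀ a ∈ LinearMap.ker (weight χ), laurentMonomial y a ∈ E)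
    (htop : Algebra.adjoin E (Set.range y) = ⊤) :
    E = IntermediateField.fixedField ρ.range := by
  have := Fintype.ofFinite G
  have hfix (g : G) (c : K) (hc : c ∈ IntermediateField.fixedField ρ.range) : ρ g c = c :=
    (IntermediateField.mem_fixedField_iff _ _).1 hc _ ⟨g, rfl⟩
  have htrace (f : K) : ∑ g, ρ g f ∈ E := by
    have hf : f ∈ Submodule.span E (Submonoid.closure (Set.range y) : Set K) := by
      rw [← Algebra.adjoin_eq_span, htop]
      trivial
    induction hf using Submodule.span_induction with
    | mem f hf =>
      obtain ⟨a, rfl⟩ := exists_laurentMonomial_of_mem_closure hy hf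
      exact sum_map_laurentMonomial_mem hρ hE a
    | zero => simp
    | add f₁ f₂ _ _ h₁ h₂ =>
      simp only [map_add, Finset.sum_add_distrib]
      exact add_mem h₁ h₂
    | smul c f _ h =>
      have (g : G) : ρ g (c • f) = c * ρ g f := by
        rw [Algebra.smul_def, map_mul]
        congr 1
        exact hfix g c (hle c.2)
      simp only [this, ← Finset.mul_sum]
      exact mul_mem c.2 h
  refine le_antisymm hle fun f hf ↦ ?_
  have h := htrace f
  simp only [hfix _ f hf, Finset.sum_const, Finset.card_univ, ← Nat.card_eq_fintype_card] at h
  have : f = (Nat.card G : k)⁻¹ • Nat.card G • f := by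
    rw [← Nat.cast_smul_eq_nsmul k, inv_smul_smul₀ hcard]
  rw [this]
  exact E.smul_mem h

/-- A finite abelian group acting diagonally on generators `y i` of a field of transcendence
degree the number of generators has a rational fixed field. -/
theorem isRational_fixedField_of_diagonal (hcard : (Nat.card G : k) ≠ 0)
    (hy : ∀ i, y i ≠ 0) (hρ : ∀ g i, ρ g (y i) = (χ i g : k) • y i)
    (hgen : IntermediateField.adjoin k (Set.range y) = ⊤)
    (htrdeg : (Fintype.card ι : Cardinal) ≤ Algebra.trdeg k K) :
    IsRational k (IntermediateField.fixedField ρ.range) := by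
  classical
  obtain ⟨m, ⟨b⟩⟩ := Submodule.nonempty_basis_of_pid (Pi.basisFun ℤ ι) (LinearMap.ker (weight χ))
  have hm : m ≤ Fintype.card ι := by
    have := Submodule.finrank_le (LinearMap.ker (weight χ))
    rwa [Module.finrank_eq_card_basis b, Module.finrank_fintype_fun_eq_card, Fintype.card_fin]
      at this
  let z : Fin m → K := fun j ↦ laurentMonomial y (b j)
  let E := IntermediateField.adjoin k (Set.range z)
  have hE (a) (ha : a ∈ LinearMap.ker (weight χ)) : laurentMonomial y a ∈ E := by
    have h : a = ∑ j, b.repr ⟨a, ha⟩ j • (b j : ι → ℤ) := by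
      have := congr_arg (Submodule.subtype _) (b.sum_repr ⟨a, ha⟩)
      rw [map_sum] at this
      exact this.symm
    rw [h, laurentMonomial_sum hy]
    refine prod_mem fun j _ ↦ ?_
    rw [laurentMonomial_zsmul]
    exact zpow_mem (IntermediateField.subset_adjoin k _ (Set.mem_range_self j)) _
  have hle : E ≤ IntermediateField.fixedField ρ.range := by
    rw [IntermediateField.adjoin_le_iff]
    rintro _ ⟨j, rfl⟩
    refine (IntermediateField.mem_fixedField_iff _ _).2 ?_
    rintro _ ⟨g, rfl⟩
    simp [z, map_laurentMonomial hρ, LinearMap.mem_ker.1 (b j).2]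
  have hint (f) (hf : f ∈ Set.range y) : IsIntegral E f := by
    obtain ⟨i, rfl⟩ := hf
    refine IsIntegral.of_pow (Nat.card_pos (α := G)) ?_
    have := hE _ (single_card_mem_ker_weight χ i)
    rw [laurentMonomial_single, zpow_natCast] at this
    exact isIntegral_algebraMap (x := (⟨_, this⟩ : E))
  have htop : Algebra.adjoin E (Set.range y) = ⊤ := by
    rw [← IntermediateField.adjoin_eq_top_iff_of_isAlgebraic fun f hf ↦ (hint f hf).isAlgebraic,
      IntermediateField.adjoin_eq_top_of_adjoin_eq_top k hgen]
  have halg : Algebra.IsAlgebraic E K := by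
    have := Algebra.IsIntegral.adjoin hint
    rw [htop] at this
    exact ⟨fun x ↦ (this.1 (⟨x, trivial⟩ : (⊤ : Subalgebra E K))).isAlgebraic.algebraMap⟩
  have halg' : Algebra.IsAlgebraic (Algebra.adjoin k (Set.range z)) K := by
    open scoped IntermediateField.algebraAdjoinAdjoin in
    exact (IsFractionRing.comap_isAlgebraic_iff (A := Algebra.adjoin k (Set.range z)) (K := E)).2
      halg
  have hz : IsTranscendenceBasis k z := by
    refine Algebra.IsAlgebraic.isTranscendenceBasis_of_lift_le_trdeg_of_finite k z ?_
    simp only [Cardinal.mk_fin, Cardinal.lift_natCast, Cardinal.lift_uzero]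
    exact (Nat.cast_le.2 hm).trans htrdeg
  rw [← fixedField_eq_of_laurentMonomial_mem hcard hy hρ hle hE htop]
  exact ⟨m, ⟨hz.1.aevalEquivField.symm⟩⟩

end DiagonalAction

section FractionRing

theorem adjoin_range_algebraMap_X_eq_top (σ k : Type*) [Field k] :
    IntermediateField.adjoin k (Set.range
      (algebraMap (MvPolynomial σ k) (FractionRing (MvPolynomial σ k)) ∘ X)) = ⊤ := by
  refine eq_top_iff.2 fun f _ ↦ ?_
  have h (p : MvPolynomial σ k) :
      algebraMap (MvPolynomial σ k) (FractionRing (MvPolynomial σ k)) p ∈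
      IntermediateField.adjoin k (Set.range
        (algebraMap (MvPolynomial σ k) (FractionRing (MvPolynomial σ k)) ∘ X)) := by
    induction p using MvPolynomial.induction_on with
    | C a => exact IntermediateField.algebraMap_mem _ a
    | add p q hp hq =>
      rw [map_add]
      exact add_mem hp hq
    | mul_X p i hp =>
      rw [map_mul]
      exact mul_mem hp (IntermediateField.subset_adjoin k _ (Set.mem_range_self i))
  obtain ⟨p, q, -, rfl⟩ := IsFractionRing.div_surjective (A := MvPolynomial σ k) f
  exact div_mem (h p) (h q)

end FractionRing

section CharacterSums

theorem natCard_ne_zero_of_isPrimitiveRoot_exponent {k G : Type*} [Field k] [CommGroup G] [Finite G]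
    {ζ : k} (hζ : IsPrimitiveRoot ζ (Monoid.exponent G)) : (Nat.card G : k) ≠ 0 := by
  have : NeZero (Monoid.exponent G) := ⟨Monoid.exponent_ne_zero_of_finite⟩
  intro h
  obtain ⟨c, hc⟩ := card_dvd_exponent_pow_rank G
  have h' := congr_arg (Nat.cast : ℕ → k) hc
  rw [Nat.cast_mul, h, zero_mul, Nat.cast_pow] at h'
  exact hζ.neZero'.out (eq_zero_of_pow_eq_zero h')

variable {k G V : Type*} [Field k] [CommGroup G]

theorem sum_monoidHom_apply_eq_zero [Finite G] [HasEnoughRootsOfUnity k (Monoid.exponent G)]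
    [Fintype (G →* kˣ)] {g : G} (hg : g ≠ 1) : ∑ χ : G →* kˣ, (χ g : k) = 0 := by
  obtain ⟨φ, hφ⟩ := CommGroup.exists_apply_ne_one_of_hasEnoughRootsOfUnity G k hg
  have h : (φ g : k) * ∑ χ : G →* kˣ, (χ g : k) = ∑ χ : G →* kˣ, (χ g : k) := by
    rw [Finset.mul_sum]
    exact Fintype.sum_equiv (Equiv.mulLeft φ) _ _ fun χ ↦ by simp
  have h' : ((φ g : k) - 1) * ∑ χ : G →* kˣ, (χ g : k) = 0 := by rw [sub_mul, h]; ring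
  exact (mul_eq_zero.1 h').resolve_left fun h ↦ hφ (Units.ext (sub_eq_zero.1 h))

variable [Fintype G] [AddCommGroup V] [Module k V]

/-- The component of the Fourier transform of the family `x` at the character `χ`. -/
def characterSum (x : G → V) (χ : G →* kˣ) : V := ∑ g, ((χ g)⁻¹ : kˣ) • x g

theorem map_characterSum {F : Type*} [FunLike F V V] [LinearMapClass F k V V] (x : G → V) (f : F)
    (h : G) (hf : ∀ g, f (x g) = x (h * g)) (χ : G →* kˣ) :
    f (characterSum x χ) = (χ h : k) • characterSum x χ := by
  simp only [characterSum, Units.smul_def, map_sum, map_smul, hf, Finset.smul_sum, smul_smul]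
  refine Fintype.sum_equiv (Equiv.mulLeft h) _ _ fun g ↦ ?_
  simp only [Equiv.coe_mulLeft, map_mul, mul_inv, ← Units.val_mul, mul_inv_cancel_left]

theorem sum_smul_characterSum [HasEnoughRootsOfUnity k (Monoid.exponent G)]
    [Fintype (G →* kˣ)] (x : G → V) (h : G) :
    ∑ χ : G →* kˣ, (χ h : k) • characterSum x χ = (Nat.card G : k) • x h := by
  classical
  simp only [characterSum, Units.smul_def, Finset.smul_sum, smul_smul]
  rw [Finset.sum_comm, Finset.sum_eq_single h]
  · simp [← Nat.card_eq_fintype_card, CommGroup.card_monoidHom_of_hasEnoughRootsOfUnity G k,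
      ← Nat.cast_smul_eq_nsmul k]
  · intro g _ hg
    rw [← Finset.sum_smul]
    have := sum_monoidHom_apply_eq_zero (k := k) (mul_inv_eq_one.not.2 hg.symm)
    simp only [map_mul, map_inv, Units.val_mul] at this
    rw [this, zero_smul]
  · simp

theorem characterSum_ne_zero {x : G → V} (hx : LinearIndependent k x) (χ : G →* kˣ) :
    characterSum x χ ≠ 0 := fun h ↦
  (χ 1)⁻¹.ne_zero (Fintype.linearIndependent_iff.1 hx (fun g ↦ ((χ g)⁻¹ : kˣ)) h 1)

end CharacterSums

/-- **Fischer's theorem.** Let `G` be a finite abelian group of exponent `e`, and `k` a field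
such that (i) `char k = 0`, or `char k = p > 0` with `p ∤ e`, and (ii) `k` contains a primitive
`e`-th root of unity. Let `G` act on the rational function field `k(x_g : g ∈ G)` by the
regular permutation action `h · x_g = x_{hg}`. Then the Noether invariant field
`k(G) = k(x_g : g ∈ G)^G` is `k`-rational. -/
theorem fischer_noether_abelian
    (k : Type*) [Field k] (G : Type*) [CommGroup G] [Finite G] (e : ℕ)
    (he : Monoid.exponent G = e)
    (hchar : ringChar k = 0 ∨ (0 < ringChar k ∧ ¬ ringChar k ∣ e))
    (hroot : ∃ ζ : k, IsPrimitiveRoot ζ e)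
    (ρ : G →* (FractionRing (MvPolynomial G k) ≃ₐ[k] FractionRing (MvPolynomial G k)))
    (hperm : ∀ g h : G, ρ g (algebraMap (MvPolynomial G k) _ (X h)) =
      algebraMap (MvPolynomial G k) _ (X (g * h))) :
    IsRational k (IntermediateField.fixedField ρ.range) := by
  subst he
  obtain ⟨ζ, hζ⟩ := hroot
  have := Fintype.ofFinite G
  have : NeZero (Monoid.exponent G) := ⟨Monoid.exponent_ne_zero_of_finite⟩
  have : HasEnoughRootsOfUnity k (Monoid.exponent G) := ⟨⟨ζ, hζ⟩, inferInstance⟩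
  have hG := CommGroup.card_monoidHom_of_hasEnoughRootsOfUnity G k
  have : Finite (G →* kˣ) := Nat.finite_of_card_ne_zero (hG ▸ Nat.card_pos.ne')
  have := Fintype.ofFinite (G →* kˣ)
  have hcard := natCard_ne_zero_of_isPrimitiveRoot_exponent hζ
  let x : G → FractionRing (MvPolynomial G k) :=
    algebraMap (MvPolynomial G k) (FractionRing (MvPolynomial G k)) ∘ X
  have : Algebra.IsAlgebraic (MvPolynomial G k) (FractionRing (MvPolynomial G k)) :=
    IsLocalization.isAlgebraic _ (nonZeroDivisors (MvPolynomial G k))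
  have hx : IsTranscendenceBasis k x := (IsTranscendenceBasis.mvPolynomial G k).algebraMap_comp
  refine isRational_fixedField_of_diagonal (y := characterSum (k := k) x) (χ := id) hcard
    (characterSum_ne_zero hx.1.linearIndependent)
    (fun g χ ↦ map_characterSum x (ρ g) g (hperm g) χ) ?_ ?_
  · have hmem (g : G) :
        x g ∈ IntermediateField.adjoin k (Set.range (characterSum (k := k) x)) := by
      rw [← inv_smul_smul₀ hcard (x g), ← sum_smul_characterSum]
      exact IntermediateField.smul_mem _ (sum_mem fun χ _ ↦ IntermediateField.smul_mem _
        (IntermediateField.subset_adjoin k _ (Set.mem_range_self χ)))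
    rw [eq_top_iff, ← adjoin_range_algebraMap_X_eq_top, IntermediateField.adjoin_le_iff]
    rintro _ ⟨g, rfl⟩
    exact hmem g
  · have h := hx.lift_cardinalMk_eq_trdeg
    rw [← Nat.card_eq_fintype_card, hG, Nat.card_eq_fintype_card]
    simpa using h.le
end
end
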